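/- arXiv:1908.03644 — 2 statements merged into one kernel-verified Lean document; each statement's English description precedes it below -/
import Mathlib

section
/- Petrović's theorem on movable zeros: the following are equivalent. (a) The zeros of the general solution do not depend on the constants of integration: there is no nonsingular point x₀ ∈ U of the equation and no solution of F = 0 with a (possibly critical) zero of some order λ = l/s > 0 at x₀. (b) The Petrović polygon of the equation contains no left slanted edge: there is no λ > 0 and no pair of distinct points Q_i ≠ Q_{i'} with λM_i − N_i = λM_{i'} − N_{i'} = min_{i''}(λM_{i''} − N_{i''}). -/
open scoped Topology

/-- A first-order algebraic ODE `F(x, y, y') = 0` with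
`F = ∑ i, φ i x * y ^ (m₀ i) * (y') ^ (m₁ i)`, pairwise distinct exponent pairs,
and coefficients `φ i` analytic on a domain `U`, none identically zero. -/
structure FirstOrderAlgODE where
  /-- number of monomials -/
  j : ℕ
  hj : 1 ≤ j
  /-- exponent of `y` in the `i`-th monomial -/
  m₀ : Fin j → ℕ
  /-- exponent of `y'` in the `i`-th monomial -/
  m₁ : Fin j → ℕ
  hdistinct : ∀ i i' : Fin j, m₀ i = m₀ i' → m₁ i = m₁ i' → i = i'
  /-- the coefficients -/
  φ : Fin j → ℂ → ℂ
  /-- the domain -/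
  U : Set ℂ
  hUopen : IsOpen U
  hUconn : IsPreconnected U
  hUne : U.Nonempty
  hφ : ∀ i, ∀ x ∈ U, AnalyticAt ℂ (φ i) x
  hφne : ∀ i, ∃ x ∈ U, φ i x ≠ 0

namespace FirstOrderAlgODE

variable (E : FirstOrderAlgODE)

/-- `M i`, the abscissa of the Petrović point `Q i = (M i, N i)`. -/
def M (i : Fin E.j) : ℕ := E.m₀ i + E.m₁ i

/-- `N i`, the ordinate of the Petrović point `Q i = (M i, N i)`. -/
def N (i : Fin E.j) : ℕ := E.m₁ i

/-- `x₀` is a nonsingular point of the equation: it lies in `U` and every coefficient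
is analytic and nonvanishing at `x₀`. -/
def Nonsingular (x₀ : ℂ) : Prop :=
  x₀ ∈ E.U ∧ ∀ i, AnalyticAt ℂ (E.φ i) x₀ ∧ E.φ i x₀ ≠ 0

/-- The Petrović polygon of the equation has an edge with angular coefficient `lam`:
the minimum of `λ M - N` over the points `Q i` is attained at two distinct points. -/
def HasEdge (lam : ℝ) : Prop :=
  ∃ i i' : Fin E.j,
    ((E.M i, E.N i) ≠ (E.M i', E.N i')) ∧
    lam * (E.M i : ℝ) - (E.N i : ℝ) = lam * (E.M i' : ℝ) - (E.N i' : ℝ) ∧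
    ∀ i'' : Fin E.j, lam * (E.M i : ℝ) - (E.N i : ℝ) ≤ lam * (E.M i'' : ℝ) - (E.N i'' : ℝ)

/-- A solution of `F = 0` with a (possibly critical) zero of order `λ = l / s` at `x₀`:
a holomorphic `u` on `{|t| < r}` with `u t = c₀ t ^ l + O(t ^ (l + 1))`, `c₀ ≠ 0`,
solving the equation pulled back along `x = x₀ + t ^ s`. -/
def SolutionWithZero (x₀ : ℂ) (l s : ℕ) : Prop :=
  ∃ r : ℝ, 0 < r ∧ ∃ u : ℂ → ℂ, ∃ c₀ : ℂ, c₀ ≠ 0 ∧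
    DifferentiableOn ℂ u (Metric.ball (0 : ℂ) r) ∧
    (fun t : ℂ => u t - c₀ * t ^ l) =O[𝓝[≠] (0 : ℂ)] (fun t : ℂ => t ^ (l + 1)) ∧
    ∀ t : ℂ, 0 < ‖t‖ → ‖t‖ < r →
      ∑ i : Fin E.j, E.φ i (x₀ + t ^ s) * u t ^ E.m₀ i *
        (deriv u t / ((s : ℂ) * t ^ (s - 1))) ^ E.m₁ i = 0

/-- A solution of `F = 0` with a (possibly critical) pole of order `λ = l / s` at `x₀`:
a holomorphic `u` on the punctured disk `{0 < |t| < r}`, meromorphic at `0` with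
`u t = c₀ t ^ (-l) + O(t ^ (-l + 1))`, `c₀ ≠ 0`, solving the equation pulled back along
`x = x₀ + t ^ s`. -/
def SolutionWithPole (x₀ : ℂ) (l s : ℕ) : Prop :=
  ∃ r : ℝ, 0 < r ∧ ∃ u : ℂ → ℂ, ∃ c₀ : ℂ, c₀ ≠ 0 ∧
    DifferentiableOn ℂ u {t : ℂ | 0 < ‖t‖ ∧ ‖t‖ < r} ∧
    (fun t : ℂ => u t - c₀ * t ^ (-(l : ℤ))) =O[𝓝[≠] (0 : ℂ)]
      (fun t : ℂ => t ^ (-(l : ℤ) + 1)) ∧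
    ∀ t : ℂ, 0 < ‖t‖ → ‖t‖ < r →
      ∑ i : Fin E.j, E.φ i (x₀ + t ^ s) * u t ^ E.m₀ i *
        (deriv u t / ((s : ℂ) * t ^ (s - 1))) ^ E.m₁ i = 0

end FirstOrderAlgODE

section PetrovicAux

open Filter

/-- telescoping piece -/
noncomputable def divPiece (n : ℕ) (p : ContinuousMultilinearMap ℂ (fun _ : Fin (n+1) => ℂ × ℂ) ℂ)
    (k : Fin (n+1)) : ContinuousMultilinearMap ℂ (fun _ : Fin n => ℂ × ℂ) ℂ :=
  (p.curryMid k ((0:ℂ),(1:ℂ))).compContinuousLinearMap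
    (fun j : Fin n => if j.castSucc < k then
      ((ContinuousLinearMap.inl ℂ ℂ ℂ).comp (ContinuousLinearMap.fst ℂ ℂ ℂ))
      else ContinuousLinearMap.id ℂ (ℂ × ℂ))

noncomputable def divSeries (p : FormalMultilinearSeries ℂ (ℂ × ℂ) ℂ) :
    FormalMultilinearSeries ℂ (ℂ × ℂ) ℂ := fun n => ∑ k : Fin (n+1), divPiece n (p (n+1)) k

lemma divPiece_norm (n : ℕ) (p : ContinuousMultilinearMap ℂ (fun _ : Fin (n+1) => ℂ × ℂ) ℂ)
    (k : Fin (n+1)) : ‖divPiece n p k‖ ≤ ‖p‖ := by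
  refine (ContinuousMultilinearMap.norm_compContinuousLinearMap_le _ _).trans ?_
  have h1 : ‖p.curryMid k ((0:ℂ),(1:ℂ))‖ ≤ ‖p‖ := by
    refine ((p.curryMid k).le_opNorm _).trans ?_
    rw [ContinuousMultilinearMap.norm_curryMid]
    simp [Prod.norm_def]
  have h2 : ∏ j : Fin n, ‖(if j.castSucc < k then
      ((ContinuousLinearMap.inl ℂ ℂ ℂ).comp (ContinuousLinearMap.fst ℂ ℂ ℂ))
      else ContinuousLinearMap.id ℂ (ℂ × ℂ))‖ ≤ 1 := by
    apply Finset.prod_le_one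
    · intros; positivity
    · intro j _
      split_ifs
      · refine ContinuousLinearMap.opNorm_le_bound _ zero_le_one ?_
        intro x
        simp [Prod.norm_def]
      · exact ContinuousLinearMap.norm_id_le
  calc _ ≤ ‖p‖ * 1 := by gcongr
    _ = _ := mul_one _

lemma divSeries_norm (p : FormalMultilinearSeries ℂ (ℂ × ℂ) ℂ) (n : ℕ) :
    ‖divSeries p n‖ ≤ (n+1) * ‖p (n+1)‖ := by
  refine (norm_sum_le _ _).trans ?_
  refine (Finset.sum_le_sum (fun k _ => divPiece_norm n _ k)).trans ?_
  simp

lemma divSeries_radius (p : FormalMultilinearSeries ℂ (ℂ × ℂ) ℂ) (hp : 0 < p.radius) :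
    0 < (divSeries p).radius := by
  obtain ⟨C, r, hC, hr, h⟩ := p.le_mul_pow_of_radius_pos hp
  have hr2 : (0:ℝ) < 1 / (2 * r) := by positivity
  obtain ⟨ρ, hρ⟩ : ∃ ρ : NNReal, (ρ : ℝ) = 1 / (2 * r) := ⟨⟨1 / (2 * r), hr2.le⟩, rfl⟩
  have : (ρ : ENNReal) ≤ (divSeries p).radius := by
    apply FormalMultilinearSeries.le_radius_of_bound _ (C * r)
    intro n
    rw [hρ]
    have h1 := divSeries_norm p n
    have h2 := h (n+1)
    have h3 : ((n:ℝ)+1) ≤ 2^n := by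
      have : n + 1 ≤ 2^n := Nat.lt_two_pow_self
      exact_mod_cast this
    calc ‖divSeries p n‖ * (1 / (2 * r))^n ≤ ((2^n) * (C * r^(n+1))) * (1 / (2 * r))^n := by
          gcongr
          exact h1.trans (by gcongr)
      _ = C * r := by rw [div_pow, mul_pow, one_pow, pow_succ]; field_simp
  refine lt_of_lt_of_le ?_ this
  rw [← hρ] at hr2
  exact_mod_cast hr2

lemma divPiece_apply (n : ℕ) (p : ContinuousMultilinearMap ℂ (fun _ : Fin (n+1) => ℂ × ℂ) ℂ)
    (y : ℂ × ℂ) :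
    p (fun _ => y) - p (fun _ => (y.1, 0)) = y.2 * ∑ k : Fin (n+1), divPiece n p k (fun _ => y) := by
  let T : ℕ → ℂ := fun k => p (fun j => if (j:ℕ) < k then (y.1, 0) else y)
  have hT : ∀ k : Fin (n+1), T k - T (k+1) = y.2 * divPiece n p k (fun _ => y) := by
    intro k
    have e1 : (fun j : Fin (n+1) => if (j:ℕ) < (k:ℕ) then (y.1, 0) else y) =
      Function.update (fun j : Fin (n+1) => if (j:ℕ) < (k:ℕ) then (y.1, 0) else y) k y := by
      ext1 j; by_cases hj : j = k
      · subst hj; simp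
      · simp [hj]
    have e2 : (fun j : Fin (n+1) => if (j:ℕ) < (k:ℕ) + 1 then (y.1, 0) else y) =
      Function.update (fun j : Fin (n+1) => if (j:ℕ) < (k:ℕ) then (y.1, 0) else y) k (y.1,0) := by
      ext1 j; by_cases hj : j = k
      · subst hj; simp
      · have : (j:ℕ) ≠ k := fun h => hj (Fin.ext h)
        have : ((j:ℕ) < k + 1) ↔ ((j:ℕ) < k) := by omega
        simp [hj, this]
    simp only [T]
    rw [e1, e2, ← ContinuousMultilinearMap.map_update_sub]
    have e3 : y - (y.1, 0) = y.2 • ((0:ℂ),(1:ℂ)) := by ext <;> simp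
    rw [e3, ContinuousMultilinearMap.map_update_smul, smul_eq_mul]
    congr 1
    simp only [divPiece, ContinuousMultilinearMap.compContinuousLinearMap_apply,
      ContinuousMultilinearMap.curryMid_apply]
    congr 1
    refine Fin.eq_insertNth_iff.2 ⟨by simp, ?_⟩
    ext1 j
    simp only [Fin.removeNth]
    rw [Function.update_of_ne (Fin.succAbove_ne k j)]
    by_cases hj : j.castSucc < k
    · rw [Fin.succAbove_of_castSucc_lt _ _ hj]
      have : (j:ℕ) < k := hj
      simp [hj, this]
    · rw [Fin.succAbove_of_le_castSucc _ _ (not_lt.1 hj)]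
      have : ¬ ((j:ℕ) < k) := hj
      have h2 : ¬ ((j:ℕ) + 1 < k) := by omega
      simp [hj, h2]
  rw [Finset.mul_sum, ← Finset.sum_congr rfl (fun k _ => hT k)]
  rw [Fin.sum_univ_eq_sum_range (fun k => T k - T (k+1)), Finset.sum_range_sub']
  simp only [T]
  congr 2
  ext1 j
  have : (j:ℕ) < n + 1 := j.2
  simp [this]

lemma analytic_div_z {f : ℂ × ℂ → ℂ} {x₀ : ℂ} (hf : AnalyticAt ℂ f (x₀, 0))
    (h0 : ∀ᶠ x in 𝓝 x₀, f (x, 0) = 0) :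
    ∃ g : ℂ × ℂ → ℂ, AnalyticAt ℂ g (x₀, 0) ∧ ∀ᶠ y in 𝓝 (x₀, (0:ℂ)), f y = y.2 * g y := by
  obtain ⟨p, hp⟩ := hf
  have hrad : 0 < p.radius := hp.radius_pos
  have hq := (divSeries p).hasFPowerSeriesOnBall (divSeries_radius p hrad)
  have hq' : HasFPowerSeriesAt (divSeries p).sum (divSeries p) 0 := ⟨_, hq⟩
  refine ⟨fun y => (divSeries p).sum (y - (x₀, 0)), ?_, ?_⟩
  · have h1 : AnalyticAt ℂ (divSeries p).sum ((fun y : ℂ × ℂ => y - (x₀, 0)) (x₀, 0)) := by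
      simpa using hq'.analyticAt
    exact h1.comp (f := fun y : ℂ × ℂ => y - (x₀, 0)) (by fun_prop)
  · have hA := hp.eventually_hasSum_sub
    have hB : ∀ᶠ y in 𝓝 (x₀, (0:ℂ)), HasSum (fun n => p n (fun _ => ((y.1, (0:ℂ)) - (x₀, 0)))) (f (y.1, 0)) := by
      have : Tendsto (fun y : ℂ × ℂ => (y.1, (0:ℂ))) (𝓝 (x₀, 0)) (𝓝 (x₀, 0)) := by
        have : Continuous (fun y : ℂ × ℂ => (y.1, (0:ℂ))) := by fun_prop
        simpa using this.tendsto (x₀, (0:ℂ))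
      exact this.eventually hA
    have hC := hq'.eventually_hasSum_sub
    have hC : ∀ᶠ y in 𝓝 (x₀, (0:ℂ)), HasSum (fun n => divSeries p n (fun _ => y - (x₀, 0)))
        ((divSeries p).sum (y - (x₀, 0))) := by
      have : Tendsto (fun y : ℂ × ℂ => y - (x₀, 0)) (𝓝 (x₀, 0)) (𝓝 0) := by
        have : Continuous (fun y : ℂ × ℂ => y - (x₀, 0)) := by fun_prop
        simpa using this.tendsto (x₀, (0:ℂ))
      simpa using this.eventually hC
    have hD : ∀ᶠ y in 𝓝 (x₀, (0:ℂ)), f (y.1, 0) = 0 :=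
      (continuous_fst.tendsto (x₀, (0:ℂ))).eventually h0
    filter_upwards [hA, hB, hC, hD] with y h1 h2 h3 h4
    rw [h4] at h2
    have h5 := h1.sub h2
    rw [sub_zero] at h5
    have h6 := (hasSum_nat_add_iff' 1).2 h5
    simp only [Finset.range_one, Finset.sum_singleton] at h6
    have e0 : (p 0 fun _ : Fin 0 => y - (x₀, 0)) - p 0 (fun _ => ((y.1, (0:ℂ)) - (x₀, 0))) = 0 := by
      rw [sub_eq_zero]; congr 1; ext1 j; exact j.elim0
    rw [e0, sub_zero] at h6
    have h7 := h3.mul_left y.2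
    have : (fun n => (p (n+1) fun _ => y - (x₀, 0)) - p (n+1) (fun _ => ((y.1, (0:ℂ)) - (x₀, 0))))
      = fun n => y.2 * divSeries p n (fun _ => y - (x₀, 0)) := by
      ext1 n
      have := divPiece_apply n (p (n+1)) (y - (x₀, 0))
      simp only [Prod.fst_sub, Prod.snd_sub, sub_zero] at this
      simp only [divSeries, sum_apply]
      rw [← this]
      congr 3
      ext <;> simp
    rw [this] at h6
    exact h6.unique h7

lemma eventually_curve {x₀ : ℂ} {P : ℂ × ℂ → Prop} (h : ∀ᶠ y in 𝓝 (x₀, (0:ℂ)), P y) :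
    ∀ᶠ x in 𝓝 x₀, P (x, 0) := by
  have : Continuous (fun x : ℂ => (x, (0:ℂ))) := by fun_prop
  exact (this.tendsto x₀).eventually h

lemma analytic_curve {g : ℂ × ℂ → ℂ} {x₀ : ℂ} (hg : AnalyticAt ℂ g (x₀, 0)) :
    AnalyticAt ℂ (fun x => g (x, 0)) x₀ :=
  AnalyticAt.comp (f := fun x : ℂ => (x, (0:ℂ))) hg (by fun_prop)

lemma analytic_order_z {f : ℂ × ℂ → ℂ} {x₀ : ℂ} (hf : AnalyticAt ℂ f (x₀, 0)) :
    (∀ᶠ y in 𝓝 (x₀, (0:ℂ)), f y = 0) ∨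
    ∃ (e : ℕ) (g : ℂ × ℂ → ℂ), AnalyticAt ℂ g (x₀, 0) ∧
      (∀ᶠ y in 𝓝 (x₀, (0:ℂ)), f y = y.2 ^ e * g y) ∧ ∀ᶠ x in 𝓝[≠] x₀, g (x, 0) ≠ 0 := by
  by_cases hfin : ∃ (e : ℕ) (g : ℂ × ℂ → ℂ), AnalyticAt ℂ g (x₀, 0) ∧
      (∀ᶠ y in 𝓝 (x₀, (0:ℂ)), f y = y.2 ^ e * g y) ∧ ∀ᶠ x in 𝓝[≠] x₀, g (x, 0) ≠ 0
  · exact Or.inr hfin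
  left
  have key : ∀ e : ℕ, ∃ g : ℂ × ℂ → ℂ, AnalyticAt ℂ g (x₀, 0) ∧
      (∀ᶠ y in 𝓝 (x₀, (0:ℂ)), f y = y.2 ^ e * g y) := by
    intro e
    induction e with
    | zero => exact ⟨f, hf, by simp⟩
    | succ e ih =>
      obtain ⟨g, hg, hfg⟩ := ih
      rcases (analytic_curve hg).eventually_eq_zero_or_eventually_ne_zero with h | h
      · obtain ⟨g', hg', hgg⟩ := analytic_div_z hg h
        refine ⟨g', hg', ?_⟩
        filter_upwards [hfg, hgg] with y h1 h2
        rw [h1, h2]; ring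
      · exact absurd ⟨e, g, hg, hfg, h⟩ hfin
  obtain ⟨r, hr, hball⟩ := hf.exists_ball_analyticOnNhd
  filter_upwards [Metric.ball_mem_nhds _ hr] with y hy
  let L : ℂ → ℂ × ℂ := fun ζ => (x₀, 0) + ζ • (y - (x₀, 0))
  have hLan : ∀ ζ, AnalyticAt ℂ L ζ := fun ζ => by fun_prop
  have hLc : Continuous L := by fun_prop
  set d := ‖y - (x₀, 0)‖ with hd
  have hdr : d < r := by simpa [dist_eq_norm] using hy
  let S : Set ℂ := L ⁻¹' Metric.ball (x₀, 0) r
  have hS : Convex ℝ S := by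
    intro a ha b hb s t hs ht hst
    have : L (s • a + t • b) = s • L a + t • L b := by
      have h1 : s = 1 - t := by linarith
      subst h1
      simp only [L]
      ext <;> simp <;> ring
    simp only [S, Set.mem_preimage, this]
    exact (convex_ball (x₀, (0:ℂ)) r) ha hb hs ht hst
  have hfL : AnalyticOnNhd ℂ (f ∘ L) S := fun ζ hζ => (hball _ hζ).comp (hLan ζ)
  have h0S : (0:ℂ) ∈ S := by simp [S, L, hr]
  have h1S : (1:ℂ) ∈ S := by simpa [S, L] using hy
  have hL0 : L 0 = (x₀, 0) := by simp [L]
  have hz : ∀ᶠ ζ in 𝓝 (0:ℂ), (f ∘ L) ζ = 0 := by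
    rw [← analyticOrderAt_eq_top]
    refine ENat.eq_top_iff_forall_ge.2 fun e => ?_
    rw [natCast_le_analyticOrderAt (hfL 0 h0S)]
    obtain ⟨g, hg, hfg⟩ := key e
    have ht : Tendsto L (𝓝 0) (𝓝 (x₀, 0)) := by simpa [hL0] using hLc.tendsto 0
    refine ⟨fun ζ => y.2 ^ e * g (L ζ), ?_, ?_⟩
    · have : AnalyticAt ℂ (g ∘ L) 0 := AnalyticAt.comp (by rwa [hL0]) (hLan 0)
      exact analyticAt_const.mul this
    · filter_upwards [ht.eventually hfg] with ζ h
      simp only [Function.comp, h]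
      simp [L]; ring
  have := hfL.eqOn_zero_of_preconnected_of_eventuallyEq_zero hS.isPreconnected h0S hz h1S
  simpa [L] using this

/-- A family of polynomials with bounded degree and analytic coefficients. -/
def PolyFam (H : ℂ × ℂ → Polynomial ℂ) (y₀ : ℂ × ℂ) : Prop :=
  (∃ d : ℕ, ∀ y, (H y).natDegree ≤ d) ∧ ∀ j, AnalyticAt ℂ (fun y => (H y).coeff j) y₀

lemma PolyFam.eval_analytic {H : ℂ × ℂ → Polynomial ℂ} {y₀ : ℂ × ℂ} (h : PolyFam H y₀) (w₀ : ℂ) :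
    AnalyticAt ℂ (fun q : (ℂ × ℂ) × ℂ => (H q.1).eval q.2) (y₀, w₀) := by
  obtain ⟨⟨d, hd⟩, ha⟩ := h
  have : (fun q : (ℂ × ℂ) × ℂ => (H q.1).eval q.2) =
      fun q => ∑ j ∈ Finset.range (d+1), (H q.1).coeff j * q.2 ^ j := by
    ext1 q
    exact Polynomial.eval_eq_sum_range' (Nat.lt_succ_of_le (hd _)) _
  rw [this]
  apply Finset.analyticAt_fun_sum
  intro j _
  have h1 : AnalyticAt ℂ (fun q : (ℂ × ℂ) × ℂ => (H q.1).coeff j) (y₀, w₀) :=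
    AnalyticAt.comp (g := fun y => (H y).coeff j) (f := fun q : (ℂ × ℂ) × ℂ => q.1)
      (x := (y₀, w₀)) (ha j) analyticAt_fst
  exact h1.mul (analyticAt_snd.pow j)

lemma PolyFam.eval_comp {H : ℂ × ℂ → Polynomial ℂ} {y₀ : ℂ × ℂ} (h : PolyFam H y₀)
    {ω : ℂ × ℂ → ℂ} (hω : AnalyticAt ℂ ω y₀) : AnalyticAt ℂ (fun y => (H y).eval (ω y)) y₀ :=
  AnalyticAt.comp (f := fun y : ℂ × ℂ => (y, ω y)) (h.eval_analytic (ω y₀)) (analyticAt_id.prod hω)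

lemma PolyFam.hasse {H : ℂ × ℂ → Polynomial ℂ} {y₀ : ℂ × ℂ} (h : PolyFam H y₀) (k : ℕ) :
    PolyFam (fun y => Polynomial.hasseDeriv k (H y)) y₀ := by
  obtain ⟨⟨d, hd⟩, ha⟩ := h
  refine ⟨⟨d, fun y => (Polynomial.natDegree_hasseDeriv_le _ _).trans ((Nat.sub_le _ _).trans (hd y))⟩, ?_⟩
  intro j
  simp only [Polynomial.hasseDeriv_coeff]
  exact analyticAt_const.mul (ha _)

lemma PolyFam.taylor {H : ℂ × ℂ → Polynomial ℂ} {y₀ : ℂ × ℂ} (h : PolyFam H y₀)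
    {ω : ℂ × ℂ → ℂ} (hω : AnalyticAt ℂ ω y₀) :
    PolyFam (fun y => Polynomial.taylor (ω y) (H y)) y₀ := by
  obtain ⟨d, hd⟩ := h.1
  refine ⟨⟨d, fun y => by simpa using hd y⟩, ?_⟩
  intro j
  simp only [Polynomial.taylor_coeff]
  exact (h.hasse j).eval_comp hω

lemma PolyFam.eventually {H : ℂ × ℂ → Polynomial ℂ} {y₀ : ℂ × ℂ} (h : PolyFam H y₀) :
    ∀ᶠ y in 𝓝 y₀, PolyFam H y := by
  obtain ⟨⟨d, hd⟩, ha⟩ := h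
  have : ∀ᶠ y in 𝓝 y₀, ∀ j ∈ Finset.range (d+1), AnalyticAt ℂ (fun y => (H y).coeff j) y := by
    rw [Filter.eventually_all_finset]
    exact fun j _ => (ha j).eventually_analyticAt
  filter_upwards [this] with y hy
  refine ⟨⟨d, hd⟩, fun j => ?_⟩
  by_cases hj : j < d + 1
  · exact hy j (Finset.mem_range.2 hj)
  · have : (fun y => (H y).coeff j) = fun _ => 0 := by
      ext1 y
      exact Polynomial.coeff_eq_zero_of_natDegree_lt (lt_of_le_of_lt (hd y) (by omega))
    rw [this]; exact analyticAt_const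

lemma PolyFam.implicit {H : ℂ × ℂ → Polynomial ℂ} {y₀ : ℂ × ℂ} (h : PolyFam H y₀) {w₀ : ℂ}
    (h0 : (H y₀).eval w₀ = 0) (h1 : (H y₀).derivative.eval w₀ ≠ 0) :
    ∃ ω : ℂ × ℂ → ℂ, AnalyticAt ℂ ω y₀ ∧ ω y₀ = w₀ ∧ (∀ᶠ y in 𝓝 y₀, (H y).eval (ω y) = 0) ∧
      ∀ᶠ q in 𝓝 (y₀, w₀), (H q.1).eval q.2 = 0 → ω q.1 = q.2 := by
  let f : (ℂ × ℂ) × ℂ → ℂ := fun q => (H q.1).eval q.2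
  have hf : AnalyticAt ℂ f (y₀, w₀) := h.eval_analytic w₀
  have cdf : ContDiffAt ℂ ⊤ f (y₀, w₀) := hf.contDiffAt
  have e1 : fderiv ℂ f (y₀, w₀) ∘L .inr ℂ (ℂ × ℂ) ℂ =
      ContinuousLinearMap.toSpanSingleton ℂ ((H y₀).derivative.eval w₀) := by
    have hc : HasFDerivAt (fun w : ℂ => f (y₀, w)) (fderiv ℂ f (y₀, w₀) ∘L .inr ℂ (ℂ × ℂ) ℂ) w₀ :=
      HasFDerivAt.comp w₀ hf.differentiableAt.hasFDerivAt (hasFDerivAt_prodMk_right y₀ w₀)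
    exact hc.unique ((H y₀).hasDerivAt w₀).hasFDerivAt
  have if₂ : (fderiv ℂ f (y₀, w₀) ∘L .inr ℂ (ℂ × ℂ) ℂ).IsInvertible := by
    rw [e1]
    refine ⟨ContinuousLinearEquiv.unitsEquivAut ℂ (Units.mk0 _ h1), ?_⟩
    ext; simp
  have htop : (⊤ : WithTop ℕ∞) ≠ 0 := by simp
  have hf0 : f (y₀, w₀) = 0 := h0
  refine ⟨cdf.implicitFunction htop if₂, ?_, cdf.implicitFunction_apply_self htop if₂, ?_, ?_⟩
  · exact (cdf.contDiffAt_implicitFunction htop if₂).analyticAt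
  · have := cdf.eventually_apply_implicitFunction htop if₂
    rw [hf0] at this
    exact this
  · filter_upwards [cdf.eventually_apply_eq_iff_implicitFunction htop if₂] with q hq hz
    rw [hf0] at hq
    exact hq.1 hz

lemma PolyFam.hurwitz {H : ℂ × ℂ → Polynomial ℂ} {y₀ : ℂ × ℂ} (h : PolyFam H y₀) {w₀ : ℂ}
    (h0 : (H y₀).eval w₀ = 0) (h1 : H y₀ ≠ 0) {δ : ℝ} (hδ : 0 < δ) :
    ∀ᶠ y in 𝓝 y₀, ∃ w, ‖w - w₀‖ ≤ δ ∧ (H y).eval w = 0 := by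
  have hcont : ∀ w, ContinuousAt (fun q : (ℂ × ℂ) × ℂ => (H q.1).eval q.2) (y₀, w) :=
    fun w => (h.eval_analytic w).continuousAt
  obtain ⟨r, hr0, hrδ, hr⟩ : ∃ r : ℝ, 0 < r ∧ r ≤ δ ∧ ∀ w ∈ Metric.sphere w₀ r, (H y₀).eval w ≠ 0 := by
    have hfin : (Set.image (fun w => ‖w - w₀‖) {w | (H y₀).IsRoot w}).Finite :=
      (Polynomial.finite_setOfPred_isRoot h1).image _
    obtain ⟨r, hr, hr2⟩ := (Set.Ioo_infinite hδ).exists_notMem_finite hfin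
    refine ⟨r, hr.1, hr.2.le, fun w hw hz => hr2 ⟨w, hz, ?_⟩⟩
    simpa [dist_eq_norm] using hw
  have hK : IsCompact (Metric.sphere w₀ r) := isCompact_sphere _ _
  obtain ⟨c, hc, hcb⟩ : ∃ c : ℝ, 0 < c ∧ ∀ w ∈ Metric.sphere w₀ r, c ≤ ‖(H y₀).eval w‖ := by
    obtain ⟨w1, hw1, hmin⟩ := hK.exists_isMinOn (NormedSpace.sphere_nonempty.2 hr0.le)
      ((H y₀).continuous.norm.continuousOn)
    exact ⟨_, norm_pos_iff.2 (hr w1 hw1), fun w hw => hmin hw⟩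
  have hA : ∀ᶠ y in 𝓝 y₀, ∀ w ∈ Metric.sphere w₀ r, c / 2 < ‖(H y).eval w‖ := by
    apply hK.eventually_forall_of_forall_eventually (P := fun y w => c / 2 < ‖(H y).eval w‖)
    intro w hw
    exact (hcont w).norm.eventually (lt_mem_nhds (by have := hcb w hw; simp only; linarith))
  have hB : ∀ᶠ y in 𝓝 y₀, ‖(H y).eval w₀‖ < c / 8 := by
    have : ContinuousAt (fun y => (H y).eval w₀) y₀ := (h.eval_comp analyticAt_const).continuousAt
    exact this.norm.eventually (gt_mem_nhds (by simp only [h0, norm_zero]; linarith))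
  filter_upwards [hA, hB] with y h1 h2
  have hne : ∀ w ∈ Metric.sphere w₀ r, 3 * c / 8 ≤ ‖(H y).eval w - (H y).eval w₀‖ := by
    intro w hw
    have := h1 w hw
    have := norm_sub_norm_le ((H y).eval w) ((H y).eval w₀)
    linarith
  have := DiffContOnCl.ball_subset_image_closedBall (f := fun w => (H y).eval w) (z₀ := w₀) (r := r)
    (ε := 3 * c / 8) (H y).differentiable.diffContOnCl hr0 hne ?_
  · obtain ⟨w, hw, hw2⟩ := this (show (0:ℂ) ∈ Metric.ball _ _ by
      simp only [Metric.mem_ball, dist_eq_norm, zero_sub, norm_neg]; linarith)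
    exact ⟨w, (by simpa [dist_eq_norm] using hw : ‖w - w₀‖ ≤ r).trans hrδ, hw2⟩
  · intro hcon
    simp only [not_not] at hcon
    have hcst := AnalyticOnNhd.eq_of_eventuallyEq (f := fun w => (H y).eval w)
      (g := fun _ => (H y).eval w₀) (fun w _ => (H y).differentiable.analyticAt w)
      (fun w _ => analyticAt_const) hcon
    obtain ⟨w1, hw1⟩ := (NormedSpace.sphere_nonempty (x := w₀)).2 hr0.le
    have h3 := hne w1 hw1
    have h4 := congrFun hcst w1
    rw [h4, sub_self, norm_zero] at h3
    linarith

lemma exists_mult {P : Polynomial ℂ} (hP : P ≠ 0) {w : ℂ} (hw : P.eval w = 0) :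
    ∃ m : ℕ, 1 ≤ m ∧ (∀ j < m, (Polynomial.taylor w P).coeff j = 0) ∧
      (Polynomial.taylor w P).coeff m ≠ 0 := by
  have h1 : Polynomial.taylor w P ≠ 0 := by
    intro h
    exact hP (Polynomial.taylor_injective w (by simpa using h))
  have h2 : ∃ n, (Polynomial.taylor w P).coeff n ≠ 0 := by
    by_contra! h
    exact h1 (Polynomial.ext (by simpa using h))
  classical
  refine ⟨Nat.find h2, ?_, fun j hj => not_not.1 (Nat.find_min h2 hj), Nat.find_spec h2⟩
  rw [Nat.one_le_iff_ne_zero]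
  intro h0
  have := Nat.find_spec h2
  rw [h0] at this
  simp [hw] at this

lemma derivative_hasse_eval (P : Polynomial ℂ) (w : ℂ) {m : ℕ} (hm : 1 ≤ m) :
    (Polynomial.hasseDeriv (m-1) P).derivative.eval w = m * (Polynomial.hasseDeriv m P).eval w := by
  obtain ⟨n, rfl⟩ : ∃ n, m = n + 1 := ⟨m - 1, by omega⟩
  have := congrArg (fun L => (L P).eval w) (Polynomial.hasseDeriv_comp (R := ℂ) 1 n)
  simp only [LinearMap.comp_apply, Polynomial.hasseDeriv_one, Nat.choose_one_right,
    LinearMap.smul_apply, Polynomial.eval_smul] at this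
  rw [add_comm 1 n] at this
  simpa using this

/-- the rescaled coefficients -/
lemma rescale {m : ℕ} {x₀ : ℂ} {h : ℕ → ℂ × ℂ → ℂ}
    (ha : ∀ j, AnalyticAt ℂ (h j) (x₀, 0)) (hm : 1 ≤ m)
    (hm1 : ∀ᶠ y in 𝓝 (x₀, (0:ℂ)), h (m-1) y = 0)
    (h0 : ¬ ∀ᶠ y in 𝓝 (x₀, (0:ℂ)), h 0 y = 0)
    (hII : ∀ j < m, ¬ ∀ᶠ x in 𝓝[≠] x₀, h j (x, 0) ≠ 0) :
    ∃ (a b : ℕ) (κ : ℕ → ℂ × ℂ → ℂ), 1 ≤ a ∧ 1 ≤ b ∧ (∀ j, AnalyticAt ℂ (κ j) (x₀, 0)) ∧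
      (∀ j, ∀ᶠ y in 𝓝 (x₀, (0:ℂ)), y.2 ^ (a * m) * κ j y = y.2 ^ (a * j) * h j (y.1, y.2 ^ b)) ∧
      (∀ x, κ m (x, 0) = h m (x, 0)) ∧ (∀ x, κ (m-1) (x, 0) = 0) ∧
      (∀ j > m, ∀ x, κ j (x, 0) = 0) ∧ ∃ j < m, ∀ᶠ x in 𝓝[≠] x₀, κ j (x, 0) ≠ 0 := by
  classical
  have hord : ∀ j, ∃ (e : ℕ) (g : ℂ × ℂ → ℂ), (¬ ∀ᶠ y in 𝓝 (x₀, (0:ℂ)), h j y = 0) →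
      AnalyticAt ℂ g (x₀, 0) ∧
      (∀ᶠ y in 𝓝 (x₀, (0:ℂ)), h j y = y.2 ^ e * g y) ∧ ∀ᶠ x in 𝓝[≠] x₀, g (x, 0) ≠ 0 := by
    intro j
    rcases analytic_order_z (ha j) with hz | ⟨e, g, hg⟩
    · exact ⟨0, 0, fun hn => absurd hz hn⟩
    · exact ⟨e, g, fun _ => hg⟩
  choose e g hg using hord
  let J : Finset ℕ := (Finset.range m).filter (fun j => ¬ ∀ᶠ y in 𝓝 (x₀, (0:ℂ)), h j y = 0)
  have hJ : ∀ j, j ∈ J ↔ j < m ∧ ¬ ∀ᶠ y in 𝓝 (x₀, (0:ℂ)), h j y = 0 := by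
    intro j; simp only [J, Finset.mem_filter, Finset.mem_range]
  have h0J : 0 ∈ J := (hJ 0).2 ⟨by omega, h0⟩
  have hm1J : m - 1 ∉ J := fun hmem => ((hJ _).1 hmem).2 hm1
  have hepos : ∀ j ∈ J, 1 ≤ e j := by
    intro j hj
    obtain ⟨hjm, hjn⟩ := (hJ j).1 hj
    rw [Nat.one_le_iff_ne_zero]
    intro he
    obtain ⟨_, h2, h3⟩ := hg j hjn
    refine hII j hjm ?_
    filter_upwards [h3, (eventually_curve h2).filter_mono nhdsWithin_le_nhds] with x h4 h5
    rw [h5, he]; simpa using h4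
  obtain ⟨js, hjs, hmin⟩ := J.exists_min_image (fun j => (e j : ℚ) / ((m:ℚ) - j)) ⟨0, h0J⟩
  obtain ⟨hjsm, hjsn⟩ := (hJ js).1 hjs
  have hineq : ∀ j ∈ J, e js * (m - j) ≤ (m - js) * e j := by
    intro j hj
    have hjm := ((hJ j).1 hj).1
    have := hmin j hj
    have p1 : (0:ℚ) < (m:ℚ) - js := by have : (js:ℚ) < m := by exact_mod_cast hjsm
                                       linarith
    have p2 : (0:ℚ) < (m:ℚ) - j := by have : (j:ℚ) < m := by exact_mod_cast hjm
                                      linarith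
    rw [div_le_div_iff₀ p1 p2] at this
    have q : ((e js * (m - j) : ℕ) : ℚ) ≤ (((m - js) * e j : ℕ) : ℚ) := by
      push_cast [Nat.cast_sub hjm.le, Nat.cast_sub hjsm.le]
      linarith
    exact_mod_cast q
  set a := e js with ha_def
  set b := m - js with hb_def
  have ha1 : 1 ≤ a := hepos js hjs
  have hb1 : 1 ≤ b := by omega
  have hbc : ∀ {f : ℂ × ℂ → ℂ}, AnalyticAt ℂ f (x₀, 0) →
      AnalyticAt ℂ (fun y : ℂ × ℂ => f (y.1, y.2 ^ b)) (x₀, 0) := by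
    intro f hf
    refine AnalyticAt.comp (g := f) (f := fun y : ℂ × ℂ => (y.1, y.2 ^ b)) (x := (x₀, (0:ℂ))) ?_
      (analyticAt_fst.prod (analyticAt_snd.pow b))
    have : (0:ℂ) ^ b = 0 := zero_pow (by omega)
    simpa [this] using hf
  have htb : Tendsto (fun y : ℂ × ℂ => (y.1, y.2 ^ b)) (𝓝 (x₀, 0)) (𝓝 (x₀, 0)) := by
    have hc : Continuous (fun y : ℂ × ℂ => (y.1, y.2 ^ b)) := by fun_prop
    have : (0:ℂ) ^ b = 0 := zero_pow (by omega)
    simpa [this] using hc.tendsto (x₀, (0:ℂ))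
  have h0b : (0:ℂ) ^ b = 0 := zero_pow (by omega)
  let κ : ℕ → ℂ × ℂ → ℂ := fun j y =>
    if m ≤ j then y.2 ^ (a * (j - m)) * h j (y.1, y.2 ^ b)
    else if j ∈ J then y.2 ^ (b * e j - a * (m - j)) * g j (y.1, y.2 ^ b) else 0
  refine ⟨a, b, κ, ha1, hb1, ?_, ?_, ?_, ?_, ?_, js, hjsm, ?_⟩
  · intro j
    by_cases h1 : m ≤ j
    · simp only [κ, h1, if_true]
      exact (analyticAt_snd.pow _).mul (hbc (ha j))
    · by_cases h2 : j ∈ J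
      · simp only [κ, h1, h2, if_true, if_false]
        exact (analyticAt_snd.pow _).mul (hbc (hg j ((hJ j).1 h2).2).1)
      · simp only [κ, h1, h2, if_false]
        exact analyticAt_const
  · intro j
    by_cases h1 : m ≤ j
    · refine Eventually.of_forall fun y => ?_
      simp only [κ, h1, if_true]
      rw [← mul_assoc, ← pow_add, ← mul_add, Nat.add_sub_cancel' h1]
    · by_cases h2 : j ∈ J
      · filter_upwards [htb.eventually (hg j ((hJ j).1 h2).2).2.1] with y hy
        simp only [κ, h1, h2, if_true, if_false]
        rw [hy]
        have hi := hineq j h2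
        have : a * m + (b * e j - a * (m - j)) = a * j + b * e j := by
          have : a * m = a * j + a * (m - j) := by rw [← mul_add]; congr 1; omega
          omega
        rw [← mul_assoc, ← pow_add, this, pow_add, pow_mul]
        ring
      · have hz : ∀ᶠ y in 𝓝 (x₀, (0:ℂ)), h j y = 0 := by
          by_contra hn
          exact h2 ((hJ j).2 ⟨by omega, hn⟩)
        filter_upwards [htb.eventually hz] with y hy
        simp only [κ, h1, h2, if_false]
        rw [hy]; simp
  · intro x
    simp [κ, h0b]
  · intro x
    have : ¬ m ≤ m - 1 := by omega
    simp [κ, this, hm1J]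
  · intro j hj x
    have h1 : m ≤ j := by omega
    have : a * (j - m) ≠ 0 := Nat.mul_ne_zero (by omega) (by omega)
    simp only [κ, h1, if_true]
    rw [zero_pow this, zero_mul]
  · filter_upwards [(hg js hjsn).2.2] with x hx
    have h1 : ¬ m ≤ js := by omega
    have h2 : b * e js - a * (m - js) = 0 := by
      rw [← ha_def, ← hb_def, mul_comm]; simp
    simp only [κ, h1, hjs, if_true, if_false]
    rw [h2, h0b]; simpa using hx

theorem puiseux (m : ℕ) : ∀ (H : ℂ × ℂ → Polynomial ℂ) (x₀ w₀ : ℂ), PolyFam H (x₀, 0) → 1 ≤ m →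
    (∀ j < m, (Polynomial.taylor w₀ (H (x₀, 0))).coeff j = 0) →
    (Polynomial.taylor w₀ (H (x₀, 0))).coeff m ≠ 0 →
    ∀ N ∈ 𝓝 (x₀, w₀), ∃ (x₁ : ℂ) (k : ℕ) (ω : ℂ × ℂ → ℂ), 1 ≤ k ∧ AnalyticAt ℂ ω (x₁, 0) ∧
      (x₁, ω (x₁, 0)) ∈ N ∧ ∀ᶠ y in 𝓝 (x₁, (0:ℂ)), (H (y.1, y.2 ^ k)).eval (ω y) = 0 := by
  induction m using Nat.strong_induction_on with
  | _ m IH =>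
  intro H x₀ w₀ hH hm hlow htop N hN
  -- the approximate root
  have hD := hH.hasse (m-1)
  obtain ⟨ω, hωa, hω0, hωD, hωu⟩ := hD.implicit (w₀ := w₀)
    (by have := hlow (m-1) (by omega); rwa [Polynomial.taylor_coeff] at this)
    (by
      rw [derivative_hasse_eval _ _ hm]
      rw [Polynomial.taylor_coeff] at htop
      exact mul_ne_zero (by exact_mod_cast (by omega : m ≠ 0)) htop)
  let G : ℂ × ℂ → Polynomial ℂ := fun y => Polynomial.taylor (ω y) (H y)
  have hG : PolyFam G (x₀, 0) := hH.taylor hωa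
  let h : ℕ → ℂ × ℂ → ℂ := fun j y => (G y).coeff j
  have ha : ∀ j, AnalyticAt ℂ (h j) (x₀, 0) := hG.2
  have hm1 : ∀ᶠ y in 𝓝 (x₀, (0:ℂ)), h (m-1) y = 0 := by
    filter_upwards [hωD] with y hy
    simpa [h, G, Polynomial.taylor_coeff] using hy
  have hmtop : h m (x₀, 0) ≠ 0 := by simpa only [h, G, hω0] using htop
  have hmev : ∀ᶠ x in 𝓝 x₀, h m (x, 0) ≠ 0 :=
    eventually_curve ((ha m).continuousAt.eventually_ne hmtop)
  by_cases h0 : ∀ᶠ y in 𝓝 (x₀, (0:ℂ)), h 0 y = 0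
  · refine ⟨x₀, 1, ω, le_rfl, hωa, by rw [hω0]; exact mem_of_mem_nhds hN, ?_⟩
    filter_upwards [h0] with y hy
    simpa [h, G] using hy
  by_cases hI : ∃ j < m, ∀ᶠ x in 𝓝[≠] x₀, h j (x, 0) ≠ 0
  · obtain ⟨j, hjm, hj⟩ := hI
    have hS : ∀ᶠ q in 𝓝 (x₀, w₀), N ∈ 𝓝 q ∧
        ((Polynomial.hasseDeriv (m-1) (H (q.1, 0))).eval q.2 = 0 → ω (q.1, 0) = q.2) := by
      refine (eventually_eventually_nhds.2 hN).and ?_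
      have hc : Continuous (fun q : ℂ × ℂ => ((q.1, (0:ℂ)), q.2)) := by fun_prop
      exact (hc.tendsto (x₀, w₀)).eventually hωu
    obtain ⟨ε, hε, hball⟩ := Metric.eventually_nhds_iff.1 hS
    have hHne : H (x₀, 0) ≠ 0 := by
      intro hz; rw [hz] at htop; simp at htop
    have hroot0 : (H (x₀, 0)).eval w₀ = 0 := by
      simpa using hlow 0 (by omega)
    have hhur := eventually_curve (hH.hurwitz hroot0 hHne (half_pos hε))
    have hall := hj.and ((hmev.and (hhur.and ((eventually_curve hH.eventually).and
      (Metric.ball_mem_nhds x₀ hε)))).filter_mono nhdsWithin_le_nhds)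
    obtain ⟨x₁, hx1, hx2, ⟨w₁, hw1, hw2⟩, hx3, hx4⟩ := hall.exists
    have hH1 : H (x₁, 0) ≠ 0 := by
      intro hz
      apply hx2
      simp [h, G, hz]
    obtain ⟨hN1, hu1⟩ := hball (y := (x₁, w₁)) (by
      rw [Prod.dist_eq, max_lt_iff]
      exact ⟨hx4, by rw [dist_eq_norm]; linarith⟩)
    obtain ⟨m', hm', hl', ht'⟩ := exists_mult hH1 hw2
    have hlt : m' < m := by
      by_contra hge
      push Not at hge
      have h1 := hl' (m-1) (by omega)
      rw [Polynomial.taylor_coeff] at h1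
      have h2 : ω (x₁, 0) = w₁ := hu1 h1
      apply hx1
      have h3 := hl' j (by omega)
      simpa only [h, G, h2] using h3
    exact IH m' hlt H x₁ w₁ hx3 hm' hl' ht' N hN1
  · push Not at hI
    obtain ⟨a, b, κ, ha1, hb1, hκa, hκrel, hκm, hκm1, hκtop, js, hjs, hκjs⟩ :=
      rescale ha hm hm1 h0 (fun j hj hn => hI j hj hn)
    obtain ⟨d, hd⟩ := hG.1
    have hmd : m ≤ d := by
      by_contra hlt
      exact hmtop (Polynomial.coeff_eq_zero_of_natDegree_lt (lt_of_le_of_lt (hd _) (by omega)))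
    let H' : ℂ × ℂ → Polynomial ℂ := fun y =>
      ∑ j ∈ Finset.range (d+1), Polynomial.monomial j (κ j y)
    have hH'c : ∀ y j, (H' y).coeff j = if j < d + 1 then κ j y else 0 := by
      intro y j
      simp only [H', Polynomial.finsetSum_coeff, Polynomial.coeff_monomial]
      simp
    have hH'd : ∀ y, (H' y).natDegree ≤ d := by
      intro y
      rw [Polynomial.natDegree_le_iff_coeff_eq_zero]
      intro n hn
      rw [hH'c, if_neg (by omega)]
    have hH' : PolyFam H' (x₀, 0) := by
      refine ⟨⟨d, hH'd⟩, fun j => ?_⟩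
      simp only [hH'c]
      split_ifs
      · exact hκa j
      · exact analyticAt_const
    have hrel : ∀ᶠ y in 𝓝 (x₀, (0:ℂ)), ∀ v : ℂ,
        y.2 ^ (a * m) * (H' y).eval v = (G (y.1, y.2 ^ b)).eval (y.2 ^ a * v) := by
      have : ∀ᶠ y in 𝓝 (x₀, (0:ℂ)), ∀ j ∈ Finset.range (d+1),
          y.2 ^ (a * m) * κ j y = y.2 ^ (a * j) * h j (y.1, y.2 ^ b) := by
        rw [Filter.eventually_all_finset]
        exact fun j _ => hκrel j
      filter_upwards [this] with y hy v
      rw [Polynomial.eval_eq_sum_range' (Nat.lt_succ_of_le (hH'd y)),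
        Polynomial.eval_eq_sum_range' (Nat.lt_succ_of_le (hd (y.1, y.2 ^ b))), Finset.mul_sum]
      refine Finset.sum_congr rfl fun j hj => ?_
      have h1 := hy j hj
      rw [hH'c, if_pos (Finset.mem_range.1 hj), ← mul_assoc, h1, mul_pow, ← pow_mul]
      simp only [h]
      ring
    have hNω : ∀ᶠ x in 𝓝 x₀, (x, ω (x, 0)) ∈ N := by
      have : ContinuousAt (fun x => (x, ω (x, 0))) x₀ :=
        continuousAt_id.prodMk (analytic_curve hωa).continuousAt
      apply this.eventually
      simpa [hω0] using hN
    have hgood : ∀ᶠ x in 𝓝 x₀, (∀ᶠ y in 𝓝 (x, (0:ℂ)), ∀ v : ℂ,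
        y.2 ^ (a * m) * (H' y).eval v = (G (y.1, y.2 ^ b)).eval (y.2 ^ a * v)) ∧
        AnalyticAt ℂ ω (x, 0) ∧ (x, ω (x, 0)) ∈ N :=
      (eventually_curve (eventually_eventually_nhds.2 hrel)).and
        ((eventually_curve hωa.eventually_analyticAt).and hNω)
    have hall := hκjs.and ((hmev.and ((eventually_curve hH'.eventually).and
      (eventually_eventually_nhds.2 hgood))).filter_mono nhdsWithin_le_nhds)
    obtain ⟨x₁, hx1, hx2, hx3, hx4⟩ := hall.exists
    set P := H' (x₁, 0) with hP
    have hPm : P.coeff m ≠ 0 := by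
      rw [hP, hH'c, if_pos (by omega), hκm]; exact hx2
    have hPm1 : P.coeff (m-1) = 0 := by
      rw [hP, hH'c, if_pos (by omega), hκm1]
    have hPj : P.coeff js ≠ 0 := by
      rw [hP, hH'c, if_pos (by omega)]; exact hx1
    have hPtop : ∀ j > m, P.coeff j = 0 := by
      intro j hj
      rw [hP, hH'c, hκtop j hj]; simp
    have hPne : P ≠ 0 := by intro hz; rw [hz] at hPm; simp at hPm
    obtain ⟨v₁, hv1⟩ : ∃ v, P.IsRoot v := by
      apply Complex.exists_root
      refine lt_of_lt_of_le ?_ (Polynomial.le_degree_of_ne_zero hPm)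
      exact_mod_cast hm
    obtain ⟨m', hm', hl', ht'⟩ := exists_mult hPne hv1
    have hlt : m' < m := by
      by_contra hge
      push Not at hge
      have h1 := hl' (m-1) (by omega)
      rw [Polynomial.taylor_coeff] at h1
      have h2 : Polynomial.hasseDeriv (m-1) P = Polynomial.C (m * P.coeff m) * Polynomial.X := by
        ext n
        rw [Polynomial.hasseDeriv_coeff, Polynomial.coeff_C_mul, Polynomial.coeff_X]
        rcases n with _ | _ | n
        · simp [hPm1]
        · have e : 0 + 1 + (m - 1) = m := by omega
          have e' : m.choose (m-1) = m := by
            rw [Nat.choose_symm (by omega)]; simp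
          rw [e, e']; simp
        · rw [hPtop _ (by omega)]; simp
      rw [h2] at h1
      simp only [Polynomial.eval_mul, Polynomial.eval_C, Polynomial.eval_X, mul_eq_zero] at h1
      have h3 : v₁ = 0 := by
        rcases h1 with (h1 | h1) | h1
        · exact absurd (by exact_mod_cast h1 : m = 0) (by omega)
        · exact absurd h1 hPm
        · exact h1
      have h4 := hl' js (by omega)
      rw [h3, Polynomial.taylor_zero] at h4
      exact hPj h4
    have hN' : ∀ᶠ q in 𝓝 (x₁, v₁), (∀ᶠ y in 𝓝 (q.1, (0:ℂ)), ∀ v : ℂ,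
        y.2 ^ (a * m) * (H' y).eval v = (G (y.1, y.2 ^ b)).eval (y.2 ^ a * v)) ∧
        AnalyticAt ℂ ω (q.1, 0) ∧ (q.1, ω (q.1, 0)) ∈ N :=
      (continuous_fst.tendsto (x₁, v₁)).eventually hx4
    obtain ⟨x₂, k', ω', hk', hω'a, ⟨hr2, hωa2, hN2⟩, hsol⟩ :=
      IH m' hlt H' x₁ v₁ hx3 hm' hl' ht' _ hN'
    have hbk : b * k' ≠ 0 := Nat.mul_ne_zero (by omega) (by omega)
    have hka : k' * a ≠ 0 := Nat.mul_ne_zero (by omega) (by omega)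
    refine ⟨x₂, b * k', fun y => ω (y.1, y.2 ^ (b * k')) + y.2 ^ (k' * a) * ω' y,
      Nat.one_le_iff_ne_zero.2 hbk, ?_, ?_, ?_⟩
    · refine AnalyticAt.add ?_ ((analyticAt_snd.pow _).mul hω'a)
      refine AnalyticAt.comp (g := ω) (f := fun y : ℂ × ℂ => (y.1, y.2 ^ (b * k')))
        (x := (x₂, (0:ℂ))) ?_ (analyticAt_fst.prod (analyticAt_snd.pow _))
      simpa [zero_pow hbk] using hωa2
    · simpa [zero_pow hbk, zero_pow hka] using hN2
    · have htk : Tendsto (fun y : ℂ × ℂ => (y.1, y.2 ^ k')) (𝓝 (x₂, 0)) (𝓝 (x₂, 0)) := by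
        have hc : Continuous (fun y : ℂ × ℂ => (y.1, y.2 ^ k')) := by fun_prop
        have : (0:ℂ) ^ k' = 0 := zero_pow (by omega)
        simpa [this] using hc.tendsto (x₂, (0:ℂ))
      filter_upwards [htk.eventually hr2, hsol] with y h1 h2
      have h3 := h1 (ω' y)
      rw [h2, mul_zero] at h3
      simp only [G] at h3
      rw [Polynomial.taylor_eval, ← pow_mul, ← pow_mul] at h3
      rw [mul_comm b k', add_comm, ← h3]

theorem holo_ode (h : ℂ × ℂ → ℂ) (x₁ : ℂ) (hh : AnalyticAt ℂ h (x₁, 0)) :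
    ∃ x : ℂ → ℂ, AnalyticAt ℂ x 0 ∧ x 0 = x₁ ∧ ∀ᶠ z in 𝓝 (0:ℂ), HasDerivAt x (h (x z, z)) z := by
  obtain ⟨K, s, hs, hK⟩ := hh.hasStrictFDerivAt.exists_lipschitzOnWith
  have hB : ∀ᶠ y in 𝓝 (x₁, (0:ℂ)), ‖h y‖ < ‖h (x₁, 0)‖ + 1 :=
    hh.continuousAt.norm.eventually_lt_const (by linarith)
  have hA : ∀ᶠ y in 𝓝 (x₁, (0:ℂ)), AnalyticAt ℂ h y := hh.eventually_analyticAt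
  obtain ⟨ρ, hρ, hball⟩ := Metric.nhds_basis_closedBall.mem_iff.1 ((inter_mem hs (inter_mem hB hA)))
  set B := ‖h (x₁, 0)‖ + 1 with hBdef
  have hBpos : 0 < B := by positivity
  obtain ⟨r, hr, hrρ, hrB, hrK⟩ : ∃ r : ℝ, 0 < r ∧ r ≤ ρ ∧ B * r ≤ ρ ∧ K * r ≤ 1/2 := by
    refine ⟨min ρ (min (ρ / B) (1/2 / (K + 1))), ?_, ?_, ?_, ?_⟩
    · positivity
    · exact min_le_left _ _
    · calc B * _ ≤ B * (ρ / B) := by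
            gcongr; exact (min_le_right _ _).trans (min_le_left _ _)
        _ = ρ := by field_simp
    · have hK0 : (0:ℝ) ≤ K := K.2
      calc (K:ℝ) * _ ≤ (K+1) * (1/2 / (K+1)) := by
            gcongr
            · linarith
            · exact (min_le_right _ _).trans (min_le_right _ _)
        _ = 1/2 := by field_simp
  have hmem : ∀ a z : ℂ, a ∈ Metric.closedBall x₁ ρ → z ∈ Metric.ball (0:ℂ) r →
      (a, z) ∈ Metric.closedBall (x₁, (0:ℂ)) ρ := by
    intro a z ha hz
    rw [Metric.mem_closedBall, Prod.dist_eq]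
    exact max_le ha ((le_of_lt hz).trans hrρ)
  let P : (ℂ → ℂ) → Prop := fun f => DifferentiableOn ℂ f (Metric.ball 0 r) ∧
    (∀ z ∈ Metric.ball (0:ℂ) r, f z ∈ Metric.closedBall x₁ ρ) ∧ f 0 = x₁
  have step : ∀ f : {f // P f}, ∃ g : {g // P g}, ∀ z ∈ Metric.ball (0:ℂ) r,
      HasDerivAt g.1 (h (f.1 z, z)) z := by
    rintro ⟨f, hf1, hf2, hf3⟩
    have hd : DifferentiableOn ℂ (fun z => h (f z, z)) (Metric.ball 0 r) := by
      intro z hz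
      have h1 : DifferentiableAt ℂ h (f z, z) :=
        (hball (hmem _ _ (hf2 z hz) hz)).2.2.differentiableAt
      exact DifferentiableAt.comp_differentiableWithinAt (f := fun z => (f z, z)) z h1
        ((hf1 z hz).prodMk differentiableWithinAt_id)
    obtain ⟨g, hg0, hg⟩ := hd.isExactOn_ball.with_val_at 0 x₁
    have hg1 : ∀ z ∈ Metric.ball (0:ℂ) r, HasDerivAt g (h (f z, z)) z := by
      intro z hz; exact hg z hz
    refine ⟨⟨g, fun z hz => (hg1 z hz).differentiableAt.differentiableWithinAt, ?_, hg0⟩, hg1⟩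
    intro z hz
    have := (convex_ball (0:ℂ) r).norm_image_sub_le_of_norm_hasDerivWithin_le (C := B)
      (fun w hw => (hg1 w hw).hasDerivWithinAt)
      (fun w hw => (hball (hmem _ _ (hf2 w hw) hw)).2.1.le) (Metric.mem_ball_self hr) hz
    rw [hg0, sub_zero] at this
    rw [Metric.mem_closedBall, dist_eq_norm]
    refine this.trans (le_trans ?_ hrB)
    gcongr
    exact le_of_lt (by simpa using hz)
  choose T hT using step
  let f0 : {f // P f} := ⟨fun _ => x₁, differentiableOn_const _, fun z _ => by simp [hρ.le], rfl⟩
  let X : ℕ → {f // P f} := fun n => T^[n] f0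
  have hX : ∀ n, ∀ z ∈ Metric.ball (0:ℂ) r, HasDerivAt (X (n+1)).1 (h ((X n).1 z, z)) z := by
    intro n z hz
    have : X (n+1) = T (X n) := Function.iterate_succ_apply' _ _ _
    rw [this]; exact hT _ z hz
  have est : ∀ n, ∀ z ∈ Metric.ball (0:ℂ) r,
      dist ((X n).1 z) ((X (n+1)).1 z) ≤ ρ * (1/2)^n := by
    intro n
    induction n with
    | zero =>
      intro z hz
      rw [dist_comm]
      simpa [X, f0] using (X 1).2.2.1 z hz
    | succ n ih =>
      intro z hz
      have := (convex_ball (0:ℂ) r).norm_image_sub_le_of_norm_hasDerivWithin_le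
        (f := fun w => (X (n+1)).1 w - (X (n+1+1)).1 w) (C := K * (ρ * (1/2)^n))
        (fun w hw => ((hX n w hw).sub (hX (n+1) w hw)).hasDerivWithinAt)
        (fun w hw => by
          have h1 := hball (hmem _ _ ((X n).2.2.1 w hw) hw)
          have h2 := hball (hmem _ _ ((X (n+1)).2.2.1 w hw) hw)
          rw [← dist_eq_norm]
          refine (hK.dist_le_mul _ h1.1 _ h2.1).trans ?_
          gcongr
          rw [Prod.dist_eq]
          simp only [dist_self]
          exact max_le (ih w hw) (by positivity)) (Metric.mem_ball_self hr) hz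
      simp only [(X (n+1)).2.2.2, (X (n+1+1)).2.2.2, sub_self, sub_zero] at this
      rw [dist_eq_norm]
      refine this.trans ?_
      have hz' : ‖z‖ ≤ r := by exact le_of_lt (by simpa using hz)
      have : K * (ρ * (1/2)^n) * ‖z‖ ≤ K * (ρ * (1/2)^n) * r := by gcongr
      refine this.trans ?_
      have : K * (ρ * (1/2)^n) * r = (K * r) * (ρ * (1/2)^n) := by ring
      rw [this, pow_succ]
      have : (K * r) * (ρ * (1/2)^n) ≤ (1/2) * (ρ * (1/2)^n) := by gcongr
      linarith
  have lim : ∀ z, ∃ a, z ∈ Metric.ball (0:ℂ) r → Tendsto (fun n => (X n).1 z) atTop (𝓝 a) := by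
    intro z
    by_cases hz : z ∈ Metric.ball (0:ℂ) r
    · obtain ⟨a, ha⟩ := cauchySeq_tendsto_of_complete
        (cauchySeq_of_le_geometric (1/2) ρ (by norm_num) (fun n => est n z hz))
      exact ⟨a, fun _ => ha⟩
    · exact ⟨0, fun h => absurd h hz⟩
  choose x hx using lim
  have hunif : TendstoUniformlyOn (fun n => (X n).1) x atTop (Metric.ball 0 r) := by
    rw [Metric.tendstoUniformlyOn_iff]
    intro ε hε
    have ht : Tendsto (fun n : ℕ => ρ * (1/2:ℝ)^n / (1 - 1/2)) atTop (𝓝 0) := by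
      have := (tendsto_pow_atTop_nhds_zero_of_lt_one (r := (1/2:ℝ)) (by norm_num) (by norm_num))
      simpa using (this.const_mul ρ).div_const (1 - 1/2 : ℝ)
    filter_upwards [ht.eventually_lt_const hε] with n hn z hz
    rw [dist_comm]
    exact (dist_le_of_le_geometric_of_tendsto (1/2) ρ (by norm_num)
      (fun n => est n z hz) (hx z hz) n).trans_lt hn
  have hloc := hunif.tendstoLocallyUniformlyOn
  have hXd : ∀ᶠ n in atTop, DifferentiableOn ℂ (X n).1 (Metric.ball 0 r) :=
    Eventually.of_forall fun n => (X n).2.1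
  have hxd : DifferentiableOn ℂ x (Metric.ball 0 r) := hloc.differentiableOn hXd Metric.isOpen_ball
  have hxder := hloc.deriv hXd Metric.isOpen_ball
  have hnb : Metric.ball (0:ℂ) r ∈ 𝓝 (0:ℂ) := Metric.ball_mem_nhds _ hr
  refine ⟨x, hxd.analyticAt hnb, ?_, ?_⟩
  · refine tendsto_nhds_unique (hx 0 (Metric.mem_ball_self hr)) ?_
    simp only [(X _).2.2.2]
    exact tendsto_const_nhds
  · filter_upwards [hnb] with z hz
    have hdz : DifferentiableAt ℂ x z := hxd.differentiableAt (Metric.isOpen_ball.mem_nhds hz)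
    have hxz : x z ∈ Metric.closedBall x₁ ρ :=
      Metric.isClosed_closedBall.mem_of_tendsto (hx z hz)
        (Eventually.of_forall fun n => (X n).2.2.1 z hz)
    have hc : ContinuousAt h (x z, z) := (hball (hmem _ _ hxz hz)).2.2.continuousAt
    have t1 : Tendsto (fun n => h ((X n).1 z, z)) atTop (𝓝 (h (x z, z))) :=
      hc.tendsto.comp ((hx z hz).prodMk_nhds tendsto_const_nhds)
    have t2 : Tendsto (fun n => deriv (X (n+1)).1 z) atTop (𝓝 (deriv x z)) :=
      (hxder.tendsto_at hz).comp (tendsto_add_atTop_nat 1)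
    have t3 : (fun n => deriv (X (n+1)).1 z) = fun n => h ((X n).1 z, z) :=
      funext fun n => (hX n z hz).deriv
    rw [t3] at t2
    rw [tendsto_nhds_unique t1 t2]
    exact hdz.hasDerivAt

theorem local_param (x g : ℂ → ℂ) (x₁ : ℂ) (S : ℕ) (hS : 1 ≤ S) (hx : AnalyticAt ℂ x 0)
    (hx0 : x 0 = x₁) (hg : AnalyticAt ℂ g 0) (hg0 : g 0 ≠ 0)
    (hd : ∀ᶠ z in 𝓝 (0:ℂ), HasDerivAt x (z ^ (S - 1) * g z) z) :
    ∃ ζ : ℂ → ℂ, AnalyticAt ℂ ζ 0 ∧ ζ 0 = 0 ∧ deriv ζ 0 ≠ 0 ∧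
      ∀ᶠ t in 𝓝 (0:ℂ), x (ζ t) = x₁ + t ^ S := by
  have hord : analyticOrderAt (deriv x) 0 = (S - 1 : ℕ) := by
    rw [hx.deriv.analyticOrderAt_eq_natCast]
    refine ⟨g, hg, hg0, ?_⟩
    filter_upwards [hd] with z hz
    simp [hz.deriv]
  have hord2 : analyticOrderAt (fun z => x z - x 0) 0 = (S : ℕ) := by
    rw [← hx.analyticOrderAt_deriv_add_one, hord]
    norm_cast
    omega
  obtain ⟨q, hq, hq0, hxq⟩ :=
    ((hx.fun_sub analyticAt_const).analyticOrderAt_eq_natCast).1 hord2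
  obtain ⟨a, ha⟩ := IsAlgClosed.exists_pow_nat_eq (q 0) (show 0 < S by omega)
  have ha0 : a ≠ 0 := by
    rintro rfl
    rw [zero_pow (by omega)] at ha
    exact hq0 ha.symm
  let p : ℂ → ℂ := fun z => Complex.exp (Complex.log (q z / q 0) / S) * a
  have hp : AnalyticAt ℂ p 0 := by
    have h1 : AnalyticAt ℂ (fun z => q z / q 0) 0 := hq.div analyticAt_const hq0
    have h2 : AnalyticAt ℂ (fun z => Complex.log (q z / q 0)) 0 :=
      h1.clog (by simp [hq0])
    exact ((h2.div analyticAt_const (by simp; omega)).cexp).mul analyticAt_const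
  have hp0 : p 0 ≠ 0 := mul_ne_zero (Complex.exp_ne_zero _) ha0
  have hpS : ∀ᶠ z in 𝓝 (0:ℂ), p z ^ S = q z := by
    filter_upwards [hq.continuousAt.eventually_ne hq0] with z hz
    simp only [p]
    rw [mul_pow, ← Complex.exp_nat_mul, mul_div_cancel₀ _ (by simp; omega),
      Complex.exp_log (div_ne_zero hz hq0), ha]
    field_simp
  let τ : ℂ → ℂ := fun z => z * p z
  have hτ : AnalyticAt ℂ τ 0 := analyticAt_id.mul hp
  have hτ0 : τ 0 = 0 := by simp [τ]
  have hτd : deriv τ 0 = p 0 := by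
    have : deriv (id * p) 0 = p 0 := by
      simpa using ((hasDerivAt_id (0:ℂ)).mul hp.differentiableAt.hasDerivAt).deriv
    exact this
  have hτd0 : deriv τ 0 ≠ 0 := by rw [hτd]; exact hp0
  have hζ := hτ.analyticAt_localInverse hτd0
  have hζ0 : hτ.hasStrictDerivAt.localInverse _ _ _ hτd0 (τ 0) = 0 :=
    HasStrictFDerivAt.localInverse_apply_image ..
  have hζd := (hτ.hasStrictDerivAt.to_localInverse hτd0).hasDerivAt.deriv
  have hζr := hτ.hasStrictDerivAt.eventually_right_inverse hτd0
  set ζ := hτ.hasStrictDerivAt.localInverse _ _ _ hτd0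
  rw [hτ0] at hζ hζ0 hζd hζr
  refine ⟨ζ, hζ, hζ0, ?_, ?_⟩
  · rw [hζd]; exact inv_ne_zero hτd0
  · have hc : Tendsto ζ (𝓝 0) (𝓝 0) := by simpa [hζ0] using hζ.continuousAt.tendsto
    filter_upwards [hζr, hc.eventually hpS, hc.eventually hxq] with t h1 h2 h3
    rw [hx0] at h3
    simp only [sub_zero, smul_eq_mul] at h3
    rw [← h2, ← mul_pow] at h3
    have : ζ t * p (ζ t) = t := h1
    rw [this] at h3
    rw [← h3]; ring

theorem build_param (ω : ℂ × ℂ → ℂ) (x₁ : ℂ) (L S : ℕ) (hL : 1 ≤ L) (hS : 1 ≤ S)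
    (hω : AnalyticAt ℂ ω (x₁, 0)) (hω0 : ω (x₁, 0) ≠ 0) :
    ∃ ζ : ℂ → ℂ, AnalyticAt ℂ ζ 0 ∧ ζ 0 = 0 ∧ deriv ζ 0 ≠ 0 ∧
      ∀ᶠ t in 𝓝 (0:ℂ), deriv (fun t => ζ t ^ L) t * ζ t ^ S =
        ζ t ^ L * ω (x₁ + t ^ S, ζ t) * (S * t ^ (S - 1)) := by
  have hh : AnalyticAt ℂ (fun y : ℂ × ℂ => y.2 ^ (S - 1) * (L / ω y)) (x₁, 0) :=
    (analyticAt_snd.pow _).mul (analyticAt_const.div hω hω0)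
  obtain ⟨x, hx, hx0, hxd⟩ := holo_ode _ x₁ hh
  have hpair : AnalyticAt ℂ (fun z => (x z, z)) 0 := hx.prod analyticAt_id
  have hω' : AnalyticAt ℂ (fun z => ω (x z, z)) 0 :=
    AnalyticAt.fun_comp (f := fun z => (x z, z)) (by simpa [hx0] using hω) hpair
  have hω0' : ω (x 0, 0) ≠ 0 := by rwa [hx0]
  have hLc : (L : ℂ) ≠ 0 := by simp; omega
  obtain ⟨ζ, hζ, hζ0, hζd, hζx⟩ := local_param x (fun z => L / ω (x z, z)) x₁ S hS hx hx0
    (analyticAt_const.div hω' hω0') (div_ne_zero hLc hω0') hxd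
  refine ⟨ζ, hζ, hζ0, hζd, ?_⟩
  have hc : Tendsto ζ (𝓝 0) (𝓝 0) := by simpa [hζ0] using hζ.continuousAt.tendsto
  filter_upwards [hζ.eventually_analyticAt, hc.eventually hxd, hζx.eventually_nhds,
    hc.eventually (hω'.continuousAt.eventually_ne hω0')] with t h1 h2 h3 h4
  have d1 : HasDerivAt ζ (deriv ζ t) t := h1.differentiableAt.hasDerivAt
  have d2 := h2.comp t d1
  have d3 : HasDerivAt (fun t : ℂ => x₁ + t ^ S) (S * t ^ (S - 1)) t := by
    simpa using (hasDerivAt_pow S t).const_add x₁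
  have d4 := d2.unique (d3.congr_of_eventuallyEq h3)
  have h5 : x (ζ t) = x₁ + t ^ S := h3.self_of_nhds
  rw [(d1.fun_pow L).deriv, ← d4, ← h5]
  obtain ⟨S, rfl⟩ : ∃ S', S = S' + 1 := ⟨S - 1, by omega⟩
  obtain ⟨L, rfl⟩ : ∃ L', L = L' + 1 := ⟨L - 1, by omega⟩
  simp only [Nat.add_sub_cancel]
  field_simp
  ring

theorem solution_of_curve (E : FirstOrderAlgODE) (x₁ : ℂ) (k l s : ℕ) (c : ℤ) (e : Fin E.j → ℕ)
    (hk : 1 ≤ k) (hl : 1 ≤ l) (hs : 1 ≤ s)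
    (he : ∀ i, (e i : ℤ) = l * (E.M i : ℤ) - s * (E.N i : ℤ) - c)
    (ω : ℂ × ℂ → ℂ) (hω : AnalyticAt ℂ ω (x₁, 0)) (hω0 : ω (x₁, 0) ≠ 0)
    (hH : ∀ᶠ y in 𝓝 (x₁, (0:ℂ)),
      ∑ i, E.φ i y.1 * (y.2 ^ k) ^ e i * ω y ^ E.m₁ i = 0) :
    E.SolutionWithZero x₁ (k * l) (k * s) := by
  have hL : 1 ≤ k * l := Nat.mul_pos hk hl
  have hS : 1 ≤ k * s := Nat.mul_pos hk hs
  obtain ⟨ζ, hζ, hζ0, hζd, hζe⟩ := build_param ω x₁ (k * l) (k * s) hL hS hω hω0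
  have hord : analyticOrderAt (fun z => ζ z - ζ 0) 0 = (1 : ℕ) :=
    hζ.analyticOrderAt_sub_eq_one_of_deriv_ne_zero hζd
  obtain ⟨η, hη, hη0, hζη⟩ :=
    ((hζ.fun_sub analyticAt_const).analyticOrderAt_eq_natCast).1 hord
  simp only [hζ0, sub_zero, pow_one, smul_eq_mul] at hζη
  have hcurve : Tendsto (fun t : ℂ => (x₁ + t ^ (k * s), ζ t)) (𝓝 0) (𝓝 (x₁, 0)) := by
    refine Tendsto.prodMk_nhds ?_ (by simpa [hζ0] using hζ.continuousAt.tendsto)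
    have : ContinuousAt (fun t : ℂ => x₁ + t ^ (k * s)) 0 := by fun_prop
    have h := this.tendsto
    simpa [zero_pow (show k * s ≠ 0 by omega)] using h
  have hev := (hζ.eventually_analyticAt.and (hζe.and (hζη.and
    ((hη.continuousAt.eventually_ne hη0).and (hcurve.eventually hH)))))
  obtain ⟨r, hr, hball⟩ := Metric.eventually_nhds_iff_ball.1 hev
  refine ⟨r, hr, fun t => ζ t ^ (k * l), η 0 ^ (k * l), pow_ne_zero _ hη0, ?_, ?_, ?_⟩
  · intro t ht
    exact ((hball t ht).1.pow _).differentiableAt.differentiableWithinAt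
  · have hv : (fun t => η t ^ (k * l) - η 0 ^ (k * l)) =O[𝓝 0] (fun t : ℂ => t) := by
      have := (hη.pow (k * l)).differentiableAt.hasDerivAt.isBigO_sub
      simpa using this
    have h2 : (fun t : ℂ => t ^ (k * l) * (η t ^ (k * l) - η 0 ^ (k * l))) =O[𝓝 0]
        (fun t : ℂ => t ^ (k * l) * t) := (Asymptotics.isBigO_refl _ _).mul hv
    refine (Asymptotics.IsBigO.mono ?_ nhdsWithin_le_nhds)
    refine h2.congr' ?_ (by filter_upwards with t using (pow_succ _ _).symm)
    filter_upwards [hζη] with t ht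
    rw [ht, mul_pow]; ring
  · intro t ht0 htr
    obtain ⟨-, h1, h2, h3, h4⟩ := hball t (by simpa using htr)
    have ht : t ≠ 0 := norm_pos_iff.1 ht0
    have hz : ζ t ≠ 0 := by rw [h2]; exact mul_ne_zero ht h3
    simp only at h4
    set w := ω (x₁ + t ^ (k * s), ζ t)
    have hden : ((k * s : ℕ) : ℂ) * t ^ (k * s - 1) ≠ 0 :=
      mul_ne_zero (by exact_mod_cast (show k * s ≠ 0 by omega)) (pow_ne_zero _ ht)
    have hZ : ζ t ^ k ≠ 0 := pow_ne_zero _ hz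
    have hD : deriv (fun t => ζ t ^ (k * l)) t / (((k * s : ℕ) : ℂ) * t ^ (k * s - 1)) =
        (ζ t ^ k) ^ l * w / (ζ t ^ k) ^ s := by
      rw [div_eq_div_iff hden (pow_ne_zero _ hZ), ← pow_mul, ← pow_mul]
      exact h1
    have key : ∀ i, E.φ i (x₁ + t ^ (k * s)) * (ζ t ^ (k * l)) ^ E.m₀ i *
        (deriv (fun t => ζ t ^ (k * l)) t / (((k * s : ℕ) : ℂ) * t ^ (k * s - 1))) ^ E.m₁ i =
        (ζ t ^ k) ^ c * (E.φ i (x₁ + t ^ (k * s)) * (ζ t ^ k) ^ e i * w ^ E.m₁ i) := by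
      intro i
      rw [hD, pow_mul (ζ t) k l]
      set Z := ζ t ^ k
      have h5 : Z ^ (l * (E.m₀ i + E.m₁ i)) = Z ^ c * Z ^ e i * Z ^ (s * E.m₁ i) := by
        rw [← zpow_natCast, ← zpow_natCast, ← zpow_natCast, ← zpow_add₀ hZ, ← zpow_add₀ hZ, he i]
        congr 1
        simp only [FirstOrderAlgODE.M, FirstOrderAlgODE.N]
        push_cast; ring
      rw [div_pow, mul_pow, ← pow_mul Z l, ← pow_mul Z l, ← pow_mul Z s]
      rw [mul_add, pow_add] at h5
      have h6 : Z ^ (s * E.m₁ i) ≠ 0 := pow_ne_zero _ hZ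
      rw [mul_div_assoc', div_eq_iff h6]
      calc _ = E.φ i (x₁ + t ^ (k * s)) * w ^ E.m₁ i * (Z ^ (l * E.m₀ i) * Z ^ (l * E.m₁ i)) := by
            ring
        _ = _ := by rw [h5]; ring
    rw [Finset.sum_congr rfl (fun i _ => key i), ← Finset.mul_sum, h4, mul_zero]

theorem exists_nonzero_root {P : Polynomial ℂ} {a b : ℕ} (hab : a ≠ b) (ha : P.coeff a ≠ 0)
    (hb : P.coeff b ≠ 0) : ∃ w : ℂ, w ≠ 0 ∧ P.eval w = 0 := by
  have hP : P ≠ 0 := by rintro rfl; simp at ha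
  obtain ⟨Q, hQ, hdvd⟩ := Polynomial.exists_eq_pow_rootMultiplicity_mul_and_not_dvd P hP 0
  set n := P.rootMultiplicity 0
  rw [Polynomial.C_0, sub_zero] at hQ hdvd
  have hQ0 : Q.coeff 0 ≠ 0 := fun h => hdvd (Polynomial.X_dvd_iff.2 h)
  have hdeg : Q.degree ≠ 0 := by
    intro h
    rw [Polynomial.eq_C_of_degree_eq_zero h, mul_comm] at hQ
    rw [hQ, Polynomial.coeff_C_mul_X_pow] at ha hb
    have h1 : a = n := by by_contra h; simp [h] at ha
    have h2 : b = n := by by_contra h; simp [h] at hb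
    exact hab (h1.trans h2.symm)
  obtain ⟨w, hw⟩ := IsAlgClosed.exists_root Q hdeg
  refine ⟨w, ?_, ?_⟩
  · rintro rfl
    exact hQ0 (by rw [Polynomial.coeff_zero_eq_eval_zero]; exact hw)
  · rw [hQ, Polynomial.eval_mul, hw.eq_zero, mul_zero]

theorem exists_nonsingular (E : FirstOrderAlgODE) : ∃ x₀, E.Nonsingular x₀ := by
  obtain ⟨a, ha⟩ := E.hUne
  have h1 : ∀ i, ∀ᶠ x in 𝓝[≠] a, E.φ i x ≠ 0 := by
    intro i
    by_contra h
    have h2 : ∃ᶠ x in 𝓝[≠] a, E.φ i x = 0 := by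
      rw [Filter.not_eventually] at h
      exact h.mono fun x hx => not_not.1 hx
    obtain ⟨b, hb, hb0⟩ := E.hφne i
    have : AnalyticOnNhd ℂ (E.φ i) E.U := fun x hx => E.hφ i x hx
    exact hb0 (this.eqOn_zero_of_preconnected_of_frequently_eq_zero E.hUconn ha h2 hb)
  have h3 : ∀ᶠ x in 𝓝[≠] a, x ∈ E.U := nhdsWithin_le_nhds (E.hUopen.mem_nhds ha)
  obtain ⟨x, hx, hxU⟩ := ((eventually_all.2 h1).and h3).exists
  exact ⟨x, hxU, fun i => ⟨E.hφ i x hxU, hx i⟩⟩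

theorem solution_of_edge (E : FirstOrderAlgODE) (lam : ℝ) (hlam : 0 < lam) (hE : E.HasEdge lam) :
    ∃ (x₀ : ℂ) (l s : ℕ), 1 ≤ l ∧ 1 ≤ s ∧ E.Nonsingular x₀ ∧ E.SolutionWithZero x₀ l s := by
  obtain ⟨i, i', hne, heq, hmin⟩ := hE
  set dM : ℤ := (E.M i : ℤ) - E.M i' with hdM
  set dN : ℤ := (E.N i : ℤ) - E.N i' with hdN
  have hrel : lam * (dM : ℝ) = dN := by rw [hdM, hdN]; push_cast; linarith
  have hdM0 : dM ≠ 0 := by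
    intro h
    rw [h] at hrel
    have h2 : dN = 0 := by simpa using hrel.symm
    apply hne
    rw [Prod.mk.injEq]; omega
  have hdN0 : dN ≠ 0 := by
    intro h
    rw [h] at hrel
    have := mul_ne_zero hlam.ne' (Int.cast_ne_zero (α := ℝ).2 hdM0)
    exact this (by simpa using hrel)
  obtain ⟨l, hl⟩ : ∃ l : ℕ, l = dN.natAbs := ⟨_, rfl⟩
  obtain ⟨s, hs⟩ : ∃ s : ℕ, s = dM.natAbs := ⟨_, rfl⟩
  have hl1 : 1 ≤ l := by omega
  have hs1 : 1 ≤ s := by omega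
  have hls : lam * (s : ℝ) = l := by
    rw [hl, hs, Nat.cast_natAbs, Nat.cast_natAbs, Int.cast_abs, Int.cast_abs, ← hrel, abs_mul,
      abs_of_pos hlam]
  set c : ℤ := l * (E.M i : ℤ) - s * (E.N i : ℤ) with hc
  have hs0 : (0:ℝ) < s := by exact_mod_cast hs1
  have hval : ∀ a, ((l * (E.M a : ℤ) - s * (E.N a : ℤ) : ℤ) : ℝ) =
      s * (lam * (E.M a : ℝ) - (E.N a : ℝ)) := by
    intro a; push_cast; rw [← hls]; ring
  have hcmin : ∀ a, c ≤ l * (E.M a : ℤ) - s * (E.N a : ℤ) := by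
    intro a
    have : (c : ℝ) ≤ ((l * (E.M a : ℤ) - s * (E.N a : ℤ) : ℤ) : ℝ) := by
      rw [hc, hval, hval]
      exact mul_le_mul_of_nonneg_left (hmin a) hs0.le
    exact_mod_cast this
  have hci' : c = l * (E.M i' : ℤ) - s * (E.N i' : ℤ) := by
    have : (c : ℝ) = ((l * (E.M i' : ℤ) - s * (E.N i' : ℤ) : ℤ) : ℝ) := by
      rw [hc, hval, hval, heq]
    exact_mod_cast this
  let e : Fin E.j → ℕ := fun a => (l * (E.M a : ℤ) - s * (E.N a : ℤ) - c).toNat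
  have he : ∀ a, (e a : ℤ) = l * (E.M a : ℤ) - s * (E.N a : ℤ) - c := fun a =>
    Int.toNat_of_nonneg (by have := hcmin a; linarith)
  have hei : e i = 0 := by have := he i; zify; rw [this, hc]; ring
  have hei' : e i' = 0 := by have := he i'; zify; rw [this, hci']; ring
  obtain ⟨x₀, hx₀⟩ := exists_nonsingular E
  let H : ℂ × ℂ → Polynomial ℂ := fun y =>
    ∑ a, Polynomial.monomial (E.m₁ a) (E.φ a y.1 * y.2 ^ e a)
  have hHcoeff : ∀ y n, (H y).coeff n = ∑ a, if E.m₁ a = n then E.φ a y.1 * y.2 ^ e a else 0 := by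
    intro y n
    simp only [H, Polynomial.finsetSum_coeff, Polynomial.coeff_monomial]
  have hHfam : PolyFam H (x₀, 0) := by
    refine ⟨⟨∑ a, E.m₁ a, fun y => ?_⟩, fun n => ?_⟩
    · refine Polynomial.natDegree_sum_le_of_forall_le _ _ (fun a _ => ?_)
      exact (Polynomial.natDegree_monomial_le _).trans
        (Finset.single_le_sum (f := E.m₁) (fun _ _ => Nat.zero_le _) (Finset.mem_univ a))
    · simp only [hHcoeff]
      refine Finset.analyticAt_fun_sum _ (fun a _ => ?_)
      split_ifs
      · exact (AnalyticAt.fun_comp (f := fun y : ℂ × ℂ => y.1) (hx₀.2 a).1 analyticAt_fst).mul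
          (analyticAt_snd.pow _)
      · exact analyticAt_const
  have hcoef : ∀ a, e a = 0 → (H (x₀, 0)).coeff (E.m₁ a) ≠ 0 := by
    intro a ha
    rw [hHcoeff, Finset.sum_eq_single a]
    · simpa [ha] using (hx₀.2 a).2
    · intro b _ hba
      split_ifs with h
      · have hb0 : e b ≠ 0 := by
          intro hb
          apply hba
          have h1 := he a
          have h2 := he b
          rw [ha] at h1
          rw [hb] at h2
          simp only [FirstOrderAlgODE.M, FirstOrderAlgODE.N, h] at h1 h2
          push_cast at h1 h2
          have h3 : (l:ℤ) * ((E.m₀ b : ℤ) - E.m₀ a) = 0 := by linarith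
          rcases mul_eq_zero.1 h3 with h4 | h4
          · omega
          · exact E.hdistinct b a (by omega) h
        simp [hb0]
      · rfl
    · simp
  have hNN : E.m₁ i ≠ E.m₁ i' := by
    intro h
    apply hdN0
    simp only [hdN, FirstOrderAlgODE.N]
    omega
  obtain ⟨w₀, hw₀, hroot⟩ := exists_nonzero_root hNN (hcoef i hei) (hcoef i' hei')
  have hH0 : H (x₀, 0) ≠ 0 := by
    intro h; exact hcoef i hei (by rw [h]; simp)
  obtain ⟨m, hm, hlow, htop⟩ := exists_mult hH0 hroot
  have hnb : {y : ℂ × ℂ | E.Nonsingular y.1 ∧ y.2 ≠ 0} ∈ 𝓝 (x₀, w₀) := by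
    have h1 : ∀ᶠ x in 𝓝 x₀, E.Nonsingular x := by
      have hU : ∀ᶠ x in 𝓝 x₀, x ∈ E.U := E.hUopen.mem_nhds hx₀.1
      refine hU.and ?_
      refine eventually_all.2 fun a => ?_
      exact (hx₀.2 a).1.eventually_analyticAt.and
        ((hx₀.2 a).1.continuousAt.eventually_ne (hx₀.2 a).2)
    have h2 : ∀ᶠ w in 𝓝 w₀, w ≠ 0 := isOpen_ne.mem_nhds hw₀
    exact h1.prod_nhds h2
  obtain ⟨x₁, k, ω, hk, hω, ⟨hx₁, hω0⟩, hHω⟩ := puiseux m H x₀ w₀ hHfam hm hlow htop _ hnb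
  refine ⟨x₁, k * l, k * s, Nat.mul_pos hk hl1, Nat.mul_pos hk hs1, hx₁, ?_⟩
  refine solution_of_curve E x₁ k l s c e hk hl1 hs1 he ω hω hω0 ?_
  filter_upwards [hHω] with y hy
  simpa [H, Polynomial.eval_finsetSum] using hy

theorem edge_of_solution (E : FirstOrderAlgODE) (x₀ : ℂ) (l s : ℕ) (hl : 1 ≤ l) (hs : 1 ≤ s)
    (hx₀ : E.Nonsingular x₀) (hsol : E.SolutionWithZero x₀ l s) :
    E.HasEdge ((l : ℝ) / s) := by
  obtain ⟨r, hr, u, c₀, hc₀, hu, hO, heq⟩ := hsol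
  have hua : AnalyticAt ℂ u 0 := hu.analyticAt (Metric.ball_mem_nhds _ hr)
  -- factor `u = t ^ l * v`
  obtain ⟨v, hv, hv0, huv⟩ : ∃ v : ℂ → ℂ, AnalyticAt ℂ v 0 ∧ v 0 = c₀ ∧
      ∀ᶠ t in 𝓝 (0:ℂ), u t = t ^ l * v t := by
    have hd : AnalyticAt ℂ (fun t => u t - c₀ * t ^ l) 0 :=
      hua.sub (analyticAt_const.mul (analyticAt_id.pow l))
    have hord : ((l + 1 : ℕ) : ℕ∞) ≤ analyticOrderAt (fun t => u t - c₀ * t ^ l) 0 := by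
      by_contra hlt
      rw [not_le] at hlt
      obtain ⟨n, hn⟩ := ENat.ne_top_iff_exists.1 (ne_top_of_lt hlt)
      rw [← hn] at hlt
      have hnl : n < l + 1 := by exact_mod_cast hlt
      obtain ⟨g, hg, hg0, hgeq⟩ := hd.analyticOrderAt_eq_natCast.1 hn.symm
      have h1 : (fun t : ℂ => t ^ n * g t) =O[𝓝[≠] (0:ℂ)] (fun t : ℂ => t ^ (l + 1)) := by
        refine hO.congr' ?_ EventuallyEq.rfl
        refine nhdsWithin_le_nhds ?_
        filter_upwards [hgeq] with t ht
        simpa using ht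
      have h2 : g =O[𝓝[≠] (0:ℂ)] (fun t : ℂ => t ^ (l + 1 - n)) := by
        have h3 := (Asymptotics.isBigO_refl (fun t : ℂ => (t ^ n)⁻¹) (𝓝[≠] (0:ℂ))).mul h1
        refine h3.congr' ?_ ?_
        · filter_upwards [self_mem_nhdsWithin] with t ht
          have : t ^ n ≠ 0 := pow_ne_zero _ ht
          field_simp
        · filter_upwards [self_mem_nhdsWithin] with t ht
          have : t ^ n ≠ 0 := pow_ne_zero _ ht
          rw [inv_mul_eq_iff_eq_mul₀ this, ← pow_add]
          congr 1; omega
      have h3 : Tendsto (fun t : ℂ => t ^ (l + 1 - n)) (𝓝[≠] (0:ℂ)) (𝓝 0) := by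
        have : ContinuousAt (fun t : ℂ => t ^ (l + 1 - n)) 0 := by fun_prop
        have h := this.tendsto
        rw [zero_pow (by omega)] at h
        exact h.mono_left nhdsWithin_le_nhds
      have h4 := h2.trans_tendsto h3
      exact hg0 (tendsto_nhds_unique (hg.continuousAt.tendsto.mono_left nhdsWithin_le_nhds) h4)
    obtain ⟨g, hg, hgeq⟩ := (natCast_le_analyticOrderAt hd).1 hord
    refine ⟨fun t => c₀ + t * g t, analyticAt_const.add (analyticAt_id.mul hg), by simp, ?_⟩
    filter_upwards [hgeq] with t ht
    simp only [sub_zero, smul_eq_mul] at ht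
    rw [sub_eq_iff_eq_add.1 ht]; ring
  -- the minimum
  have hne : (Finset.univ : Finset (Fin E.j)).Nonempty := ⟨⟨0, E.hj⟩, Finset.mem_univ _⟩
  obtain ⟨i, -, hi⟩ := Finset.exists_min_image Finset.univ
    (fun a => (l : ℤ) * (E.M a : ℤ) - s * (E.N a : ℤ)) hne
  have hs0 : (0:ℝ) < s := by exact_mod_cast hs
  have hval : ∀ a, ((l : ℝ) / s) * (E.M a : ℝ) - (E.N a : ℝ) =
      (((l : ℤ) * (E.M a : ℤ) - s * (E.N a : ℤ) : ℤ) : ℝ) / s := by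
    intro a; push_cast; field_simp
  by_contra hno
  have huniq : ∀ b, b ≠ i → (l : ℤ) * (E.M i : ℤ) - s * (E.N i : ℤ) <
      (l : ℤ) * (E.M b : ℤ) - s * (E.N b : ℤ) := by
    intro b hb
    refine lt_of_le_of_ne (hi b (Finset.mem_univ _)) (fun h => hno ⟨i, b, ?_, ?_, ?_⟩)
    · intro h2
      rw [Prod.mk.injEq] at h2
      simp only [FirstOrderAlgODE.M, FirstOrderAlgODE.N] at h2
      exact hb (E.hdistinct b i (by omega) (by omega))
    · rw [hval, hval, h]
    · intro a
      rw [hval, hval]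
      have : (((l : ℤ) * (E.M i : ℤ) - s * (E.N i : ℤ) : ℤ) : ℝ) ≤
        (((l : ℤ) * (E.M a : ℤ) - s * (E.N a : ℤ) : ℤ) : ℝ) := by
        exact_mod_cast hi a (Finset.mem_univ _)
      gcongr
  let e : Fin E.j → ℕ := fun a => ((l * (E.M a : ℤ) - s * (E.N a : ℤ)) -
    (l * (E.M i : ℤ) - s * (E.N i : ℤ))).toNat
  have he : ∀ a, (e a : ℤ) = (l * (E.M a : ℤ) - s * (E.N a : ℤ)) -
      (l * (E.M i : ℤ) - s * (E.N i : ℤ)) := fun a =>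
    Int.toNat_of_nonneg (by have := hi a (Finset.mem_univ _); linarith)
  have hei : e i = 0 := by have := he i; zify; rw [this]; ring
  have heb : ∀ b, b ≠ i → e b ≠ 0 := by
    intro b hb h
    have h1 := he b
    have h2 := huniq b hb
    rw [h] at h1
    push_cast at h1
    linarith
  let w : ℂ → ℂ := fun t => (l * v t + t * deriv v t) / s
  have hw : AnalyticAt ℂ w 0 :=
    ((analyticAt_const.mul hv).add (analyticAt_id.mul hv.deriv)).div analyticAt_const
      (by simp; omega)
  let G : ℂ → ℂ := fun t => ∑ a, E.φ a (x₀ + t ^ s) * t ^ e a * v t ^ E.m₀ a * w t ^ E.m₁ a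
  have hGc : ContinuousAt G 0 := by
    refine tendsto_finsetSum _ (fun a _ => ?_)
    have h1 : ContinuousAt (fun t : ℂ => E.φ a (x₀ + t ^ s)) 0 := by
      refine ContinuousAt.comp' (f := fun t : ℂ => x₀ + t ^ s) ?_ (by fun_prop)
      simpa [zero_pow (show s ≠ 0 by omega)] using (hx₀.2 a).1.continuousAt
    exact ((h1.mul (continuousAt_id.pow _)).mul (hv.continuousAt.pow _)).mul
      (hw.continuousAt.pow _)
  have hG0 : ∀ᶠ t in 𝓝[≠] (0:ℂ), G t = 0 := by
    have hb : ∀ᶠ t in 𝓝 (0:ℂ), ‖t‖ < r := by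
      filter_upwards [Metric.ball_mem_nhds (0:ℂ) hr] with t ht
      simpa using ht
    rw [eventually_nhdsWithin_iff]
    filter_upwards [hb, huv.eventually_nhds, hv.eventually_analyticAt] with t htr hut hvt ht
    have ht : t ≠ 0 := ht
    have h1 := heq t (norm_pos_iff.2 ht) htr
    have hu1 : u t = t ^ l * v t := hut.self_of_nhds
    have hder : deriv u t = t ^ (l - 1) * (s * w t) := by
      have hd : HasDerivAt (fun t => t ^ l * v t) _ t :=
        (hasDerivAt_pow l t).mul hvt.differentiableAt.hasDerivAt
      rw [(hd.congr_of_eventuallyEq hut).deriv]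
      simp only [w]
      rw [mul_div_cancel₀ _ (show (s : ℂ) ≠ 0 by simp; omega)]
      obtain ⟨l, rfl⟩ : ∃ l', l = l' + 1 := ⟨l - 1, by omega⟩
      simp only [Nat.add_sub_cancel]
      ring
    have hD : deriv u t / ((s : ℂ) * t ^ (s - 1)) = t ^ l * w t / t ^ s := by
      rw [hder]
      have hsc : (s : ℂ) ≠ 0 := by simp; omega
      obtain ⟨l, rfl⟩ : ∃ l', l = l' + 1 := ⟨l - 1, by omega⟩
      obtain ⟨s, rfl⟩ : ∃ s', s = s' + 1 := ⟨s - 1, by omega⟩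
      simp only [Nat.add_sub_cancel]
      rw [div_eq_div_iff (mul_ne_zero hsc (pow_ne_zero _ ht)) (pow_ne_zero _ ht)]
      ring
    set c : ℤ := l * (E.M i : ℤ) - s * (E.N i : ℤ)
    have key : ∀ a, E.φ a (x₀ + t ^ s) * u t ^ E.m₀ a *
        (deriv u t / ((s : ℂ) * t ^ (s - 1))) ^ E.m₁ a =
        t ^ c * (E.φ a (x₀ + t ^ s) * t ^ e a * v t ^ E.m₀ a * w t ^ E.m₁ a) := by
      intro a
      rw [hD, hu1]
      have h5 : t ^ (l * (E.m₀ a + E.m₁ a)) = t ^ c * t ^ e a * t ^ (s * E.m₁ a) := by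
        rw [← zpow_natCast, ← zpow_natCast, ← zpow_natCast, ← zpow_add₀ ht, ← zpow_add₀ ht, he a]
        congr 1
        simp only [FirstOrderAlgODE.M, FirstOrderAlgODE.N]
        push_cast; ring
      rw [mul_add, pow_add] at h5
      rw [div_pow, mul_pow, mul_pow, ← pow_mul t l, ← pow_mul t l, ← pow_mul t s]
      have h6 : t ^ (s * E.m₁ a) ≠ 0 := pow_ne_zero _ ht
      rw [mul_div_assoc', div_eq_iff h6]
      calc _ = E.φ a (x₀ + t ^ s) * v t ^ E.m₀ a * w t ^ E.m₁ a *
            (t ^ (l * E.m₀ a) * t ^ (l * E.m₁ a)) := by ring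
        _ = _ := by rw [h5]; ring
    rw [Finset.sum_congr rfl (fun a _ => key a), ← Finset.mul_sum] at h1
    exact (mul_eq_zero.1 h1).resolve_left (zpow_ne_zero _ ht)
  have hlim : G 0 = 0 := tendsto_nhds_unique (hGc.tendsto.mono_left nhdsWithin_le_nhds)
    (tendsto_const_nhds.congr' (by filter_upwards [hG0] with t ht using ht.symm))
  have hGv : G 0 = E.φ i x₀ * c₀ ^ E.m₀ i * (l * c₀ / s) ^ E.m₁ i := by
    simp only [G]
    rw [Finset.sum_eq_single i]
    · simp [hei, w, hv0, zero_pow (show s ≠ 0 by omega)]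
    · intro b _ hb
      simp [heb b hb]
    · simp
  rw [hGv] at hlim
  have hlc : (l : ℂ) ≠ 0 := by simp; omega
  have hsc : (s : ℂ) ≠ 0 := by simp; omega
  exact mul_ne_zero (mul_ne_zero (hx₀.2 i).2 (pow_ne_zero _ hc₀))
    (pow_ne_zero _ (div_ne_zero (mul_ne_zero hlc hc₀) hsc)) hlim

end PetrovicAux

/-- **Petrović's theorem on movable zeros (1894).**  The zeros of the general solution
of a first-order algebraic ODE do not depend on the constants of integration (there is
no nonsingular point of the equation at which some solution has a movable
(possibly critical) zero of some positive rational order `l / s`) if and only if the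
Petrović polygon of the equation contains no left slanted edge (no edge whose angular
coefficient is positive). -/
theorem petrovic_no_movable_zeros_iff (E : FirstOrderAlgODE) :
    (¬ ∃ (x₀ : ℂ) (l s : ℕ), 1 ≤ l ∧ 1 ≤ s ∧
        E.Nonsingular x₀ ∧ E.SolutionWithZero x₀ l s) ↔
    (¬ ∃ lam : ℝ, 0 < lam ∧ E.HasEdge lam) := by
  refine not_congr ⟨?_, ?_⟩
  · rintro ⟨x₀, l, s, hl, hs, hx₀, hsol⟩
    refine ⟨(l : ℝ) / s, ?_, edge_of_solution E x₀ l s hl hs hx₀ hsol⟩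
    have h1 : (0 : ℝ) < l := by exact_mod_cast hl
    have h2 : (0 : ℝ) < s := by exact_mod_cast hs
    positivity
  · rintro ⟨lam, hlam, hE⟩
    exact solution_of_edge E lam hlam hE
end

section
/- Malmquist's theorem: let P, Q ∈ ℂ[z][w] be polynomials in w with polynomial coefficients in z, with Q ≠ 0 and P, Q coprime as polynomials in w over the field ℂ(z). Assume the equation w′ = P(z,w)/Q(z,w) is not a Riccati equation, i.e. it is not the case that deg_w Q = 0 and deg_w P ≤ 2. Then every single-valued solution of the ODE w′·Q(z,w) = P(z,w) is a rational function. -/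
/-- Evaluation of `P ∈ ℂ[z][w]` (a polynomial in `w` whose coefficients are
polynomials in `z`) at the point `(z, w)`. -/
noncomputable def evZW (P : Polynomial (Polynomial ℂ)) (z w : ℂ) : ℂ :=
  (P.map (Polynomial.evalRingHom z)).eval w

open Filter Topology Polynomial

section MalmAlg

lemma evZW_mul (F G : ℂ[X][X]) (z w : ℂ) : evZW (F * G) z w = evZW F z w * evZW G z w := by
  simp [evZW]

lemma evZW_add (F G : ℂ[X][X]) (z w : ℂ) : evZW (F + G) z w = evZW F z w + evZW G z w := by
  simp [evZW]

lemma evZW_pow (F : ℂ[X][X]) (n : ℕ) (z w : ℂ) : evZW (F ^ n) z w = evZW F z w ^ n := by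
  simp [evZW]

lemma evZW_C (r : ℂ[X]) (z w : ℂ) : evZW (C r) z w = r.eval z := by
  simp [evZW]

lemma evZW_X (z w : ℂ) : evZW X z w = w := by
  simp [evZW]

lemma evZW_neg (F : ℂ[X][X]) (z w : ℂ) : evZW (-F) z w = - evZW F z w := by
  simp [evZW]

lemma evZW_monomial (n : ℕ) (r : ℂ[X]) (z w : ℂ) :
    evZW (monomial n r) z w = r.eval z * w ^ n := by
  simp [evZW]

lemma evZW_sum (F : ℂ[X][X]) (z w : ℂ) :
    evZW F z w = ∑ i ∈ Finset.range (F.natDegree + 1), (F.coeff i).eval z * w ^ i := by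
  have h : (F.map (Polynomial.evalRingHom z)).natDegree < F.natDegree + 1 :=
    Nat.lt_succ_of_le natDegree_map_le
  unfold evZW
  rw [Polynomial.eval_eq_sum_range' h]
  simp

lemma pow_up {x : ℝ} (hx : 2 ≤ x) {a b : ℕ} (h : a ≤ b) : x ^ a ≤ x ^ b :=
  pow_le_pow_right₀ (by linarith) h

lemma pow_add_up {x : ℝ} (hx : 2 ≤ x) (a b : ℕ) : x ^ a + x ^ b ≤ x ^ (a + b + 1) := by
  have h1 : x ^ a ≤ x ^ (a + b) := pow_up hx (by omega)
  have h2 : x ^ b ≤ x ^ (a + b) := pow_up hx (by omega)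
  have h3 : 0 ≤ x ^ (a + b) := by positivity
  rw [pow_succ]
  nlinarith

lemma const_up (c : ℝ) : ∃ k : ℕ, ∀ x : ℝ, 2 ≤ x → c ≤ x ^ k := by
  obtain ⟨k, hk⟩ := pow_unbounded_of_one_lt c (by norm_num : (1:ℝ) < 2)
  refine ⟨k, fun x hx => hk.le.trans ?_⟩
  gcongr

lemma poly_upper (p : ℂ[X]) : ∃ k : ℕ, ∀ z : ℂ, 2 ≤ ‖z‖ → ‖p.eval z‖ ≤ ‖z‖ ^ k := by
  induction p using Polynomial.induction_on' with
  | add p q hp hq =>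
    obtain ⟨a, ha⟩ := hp
    obtain ⟨b, hb⟩ := hq
    refine ⟨a + b + 1, fun z hz => ?_⟩
    rw [eval_add]
    exact (norm_add_le _ _).trans ((add_le_add (ha z hz) (hb z hz)).trans (pow_add_up hz a b))
  | monomial n a =>
    obtain ⟨k, hk⟩ := const_up ‖a‖
    refine ⟨k + n, fun z hz => ?_⟩
    rw [eval_monomial, norm_mul, norm_pow, pow_add]
    gcongr
    exact hk _ hz

lemma poly_sum_upper (f : ℕ → ℂ[X]) (s : Finset ℕ) :
    ∃ k : ℕ, ∀ z : ℂ, 2 ≤ ‖z‖ → ∑ i ∈ s, ‖(f i).eval z‖ ≤ ‖z‖ ^ k := by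
  induction s using Finset.induction_on with
  | empty => exact ⟨0, fun z hz => by simp⟩
  | insert i s hi ih =>
    obtain ⟨a, ha⟩ := ih
    obtain ⟨b, hb⟩ := poly_upper (f i)
    refine ⟨b + a + 1, fun z hz => ?_⟩
    rw [Finset.sum_insert hi]
    exact (add_le_add (hb z hz) (ha z hz)).trans (pow_add_up hz b a)

lemma poly_lower (p : ℂ[X]) (hp : p ≠ 0) :
    ∃ R : ℝ, 2 ≤ R ∧ ∀ z : ℂ, R ≤ ‖z‖ → 1 ≤ ‖z‖ * ‖p.eval z‖ := by
  obtain ⟨c, hc, R, hR⟩ : ∃ c : ℝ, 0 < c ∧ ∃ R : ℝ, ∀ z : ℂ, R ≤ ‖z‖ → c ≤ ‖p.eval z‖ := by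
    by_cases hd : 0 < p.degree
    · have h := Polynomial.tendsto_norm_atTop p hd (l := Filter.comap norm atTop)
        (z := fun z : ℂ => z) tendsto_comap
      have h1 := h.eventually_ge_atTop 1
      rw [eventually_comap] at h1
      obtain ⟨R, hR⟩ := eventually_atTop.1 h1
      exact ⟨1, one_pos, R, fun z hz => hR _ hz z rfl⟩
    · have h := Polynomial.eq_C_of_degree_le_zero (not_lt.1 hd)
      refine ⟨‖p.coeff 0‖, ?_, 0, fun z _ => ?_⟩
      · rw [norm_pos_iff]
        intro h0
        rw [h0, C_0] at h
        exact hp h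
      · conv_rhs => rw [h]
        simp
  refine ⟨max 2 (max R c⁻¹), le_max_left _ _, fun z hz => ?_⟩
  have h1 : R ≤ ‖z‖ := ((le_max_left _ _).trans (le_max_right _ _)).trans hz
  have h2 : c⁻¹ ≤ ‖z‖ := ((le_max_right _ _).trans (le_max_right _ _)).trans hz
  calc (1:ℝ) = c⁻¹ * c := by field_simp
    _ ≤ ‖z‖ * ‖p.eval z‖ := by
      gcongr
      exact hR z h1

lemma ev_bound (F : ℂ[X][X]) : ∃ k : ℕ, ∀ (z w : ℂ) (M : ℝ), 2 ≤ ‖z‖ →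
    (∀ i ≤ F.natDegree, ‖w‖ ^ i ≤ M) → ‖evZW F z w‖ ≤ ‖z‖ ^ k * M := by
  obtain ⟨k, hk⟩ := poly_sum_upper F.coeff (Finset.range (F.natDegree + 1))
  refine ⟨k, fun z w M hz hM => ?_⟩
  have hM0 : 0 ≤ M := le_trans (by simp) (hM 0 (Nat.zero_le _))
  rw [evZW_sum]
  calc _ ≤ ∑ i ∈ Finset.range (F.natDegree + 1), ‖(F.coeff i).eval z * w ^ i‖ := norm_sum_le _ _
    _ ≤ ∑ i ∈ Finset.range (F.natDegree + 1), ‖(F.coeff i).eval z‖ * M := by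
      apply Finset.sum_le_sum
      intro i hi
      rw [norm_mul, norm_pow]
      gcongr
      exact hM i (Nat.lt_succ_iff.1 (Finset.mem_range.1 hi))
    _ = (∑ i ∈ Finset.range (F.natDegree + 1), ‖(F.coeff i).eval z‖) * M := by
      rw [Finset.sum_mul]
    _ ≤ _ := by
      gcongr
      exact hk z hz

lemma bi_upper (F : ℂ[X][X]) (a : ℕ) : ∃ k : ℕ, ∀ z w : ℂ, 2 ≤ ‖z‖ → ‖w‖ ≤ ‖z‖ ^ a →
    ‖evZW F z w‖ ≤ ‖z‖ ^ k := by
  obtain ⟨k, hk⟩ := ev_bound F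
  refine ⟨k + a * F.natDegree, fun z w hz hw => ?_⟩
  rw [pow_add]
  refine hk z w _ hz fun i hi => ?_
  calc ‖w‖ ^ i ≤ (‖z‖ ^ a) ^ i := by gcongr
    _ = ‖z‖ ^ (a * i) := by rw [pow_mul]
    _ ≤ _ := pow_up hz (by gcongr)

lemma root_bound (S : ℂ[X][X]) (hS : 1 ≤ S.natDegree) : ∃ R : ℝ, 2 ≤ R ∧ ∀ a : ℕ,
    ∃ k : ℕ, ∀ z w : ℂ, R ≤ ‖z‖ → ‖evZW S z w‖ ≤ ‖z‖ ^ a → ‖w‖ ≤ ‖z‖ ^ k := by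
  have hS0 : S ≠ 0 := by
    rintro rfl
    simp at hS
  obtain ⟨R, hR2, hR⟩ := poly_lower S.leadingCoeff (leadingCoeff_ne_zero.2 hS0)
  obtain ⟨b, hb⟩ := ev_bound S.eraseLead
  refine ⟨R, hR2, fun a => ⟨a + b + 2, fun z w hz hw => ?_⟩⟩
  have hz2 : 2 ≤ ‖z‖ := hR2.trans hz
  rcases le_total ‖w‖ 1 with h1 | h1
  · exact h1.trans (one_le_pow₀ (by linarith))
  obtain ⟨n, hn⟩ : ∃ n, S.natDegree = n + 1 := ⟨S.natDegree - 1, by omega⟩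
  have hE : ‖evZW S.eraseLead z w‖ ≤ ‖z‖ ^ b * ‖w‖ ^ n := by
    refine hb z w _ hz2 fun i hi => pow_le_pow_right₀ h1 ?_
    have := S.eraseLead_natDegree_le
    omega
  have hdec : evZW S z w = evZW S.eraseLead z w + S.leadingCoeff.eval z * w ^ (n + 1) := by
    conv_lhs => rw [← S.eraseLead_add_monomial_natDegree_leadingCoeff]
    rw [evZW_add, evZW_monomial, hn]
  have h2 : ‖S.leadingCoeff.eval z‖ * ‖w‖ ^ (n + 1) ≤ ‖z‖ ^ (a + b + 1) * ‖w‖ ^ n := by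
    rw [← norm_pow, ← norm_mul]
    have : S.leadingCoeff.eval z * w ^ (n + 1) = evZW S z w - evZW S.eraseLead z w := by
      rw [hdec]; ring
    rw [this]
    have hwn : 1 ≤ ‖w‖ ^ n := one_le_pow₀ h1
    calc _ ≤ ‖evZW S z w‖ + ‖evZW S.eraseLead z w‖ := norm_sub_le _ _
      _ ≤ ‖z‖ ^ a * ‖w‖ ^ n + ‖z‖ ^ b * ‖w‖ ^ n := by
        gcongr
        exact hw.trans (le_mul_of_one_le_right (by positivity) hwn)
      _ = (‖z‖ ^ a + ‖z‖ ^ b) * ‖w‖ ^ n := by ring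
      _ ≤ _ := by
        gcongr
        exact pow_add_up hz2 a b
  have h3 := hR z hz
  have h4 : ‖w‖ * ‖w‖ ^ n ≤ ‖z‖ ^ (a + b + 2) * ‖w‖ ^ n := by
    calc ‖w‖ * ‖w‖ ^ n = 1 * ‖w‖ ^ (n + 1) := by ring
      _ ≤ (‖z‖ * ‖S.leadingCoeff.eval z‖) * ‖w‖ ^ (n + 1) := by gcongr
      _ = ‖z‖ * (‖S.leadingCoeff.eval z‖ * ‖w‖ ^ (n + 1)) := by ring
      _ ≤ ‖z‖ * (‖z‖ ^ (a + b + 1) * ‖w‖ ^ n) := by gcongr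
      _ = _ := by ring
  exact le_of_mul_le_mul_right h4 (by positivity)

lemma ev_deriv (S : ℂ[X][X]) : ∃ D : ℂ[X][X], ∀ (w : ℂ → ℂ) (z d : ℂ), HasDerivAt w d z →
    HasDerivAt (fun x => evZW S x (w x))
      (evZW D z (w z) + evZW (derivative S) z (w z) * d) z := by
  induction S using Polynomial.induction_on' with
  | add p q hp hq =>
    obtain ⟨A, hA⟩ := hp
    obtain ⟨B, hB⟩ := hq
    refine ⟨A + B, fun w z d hd => ?_⟩
    simp only [evZW_add, derivative_add]
    convert! (hA w z d hd).add (hB w z d hd) using 1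
    ring
  | monomial n a =>
    refine ⟨monomial n (derivative a), fun w z d hd => ?_⟩
    simp only [evZW_monomial, derivative_monomial]
    convert! (a.hasDerivAt z).mul (hd.pow n) using 1
    simp
    ring

lemma ev_analytic (S : ℂ[X][X]) (w : ℂ → ℂ) (z : ℂ) (h : AnalyticAt ℂ w z) :
    AnalyticAt ℂ (fun x => evZW S x (w x)) z := by
  induction S using Polynomial.induction_on' with
  | add p q hp hq =>
    simp only [evZW_add]
    exact hp.add hq
  | monomial n a =>
    simp only [evZW_monomial]
    exact (a.differentiable.analyticAt z).mul (h.pow n)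

lemma ev_mero (S : ℂ[X][X]) (w : ℂ → ℂ) (z : ℂ) (h : MeromorphicAt w z) :
    MeromorphicAt (fun x => evZW S x (w x)) z := by
  induction S using Polynomial.induction_on' with
  | add p q hp hq =>
    simp only [evZW_add]
    exact hp.add hq
  | monomial n a =>
    simp only [evZW_monomial]
    exact (a.differentiable.analyticAt z).meromorphicAt.mul (h.pow n)

end MalmAlg

section MalmRat

lemma entire_poly (f : ℂ → ℂ) (hf : Differentiable ℂ f) (K : ℕ) (R : ℝ)
    (hb : ∀ z : ℂ, R < ‖z‖ → ‖f z‖ ≤ ‖z‖ ^ K) : ∃ A : ℂ[X], ∀ z, f z = A.eval z := by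
  have hzero : ∀ n : ℕ, K < n → iteratedDeriv n f 0 = 0 := by
    intro n hn
    have hbound : ∀ r : ℝ, max R 1 < r → ‖iteratedDeriv n f 0‖ ≤ n.factorial * r⁻¹ := by
      intro r hr
      have hr1 : 1 < r := (le_max_right _ _).trans_lt hr
      have hrR : R < r := (le_max_left _ _).trans_lt hr
      have hr0 : 0 < r := by linarith
      have h := Complex.norm_iteratedDeriv_le_of_forall_mem_sphere_norm_le (c := 0) (R := r)
        (C := r ^ K) (f := f) n hr0 hf.diffContOnCl (by
          intro z hz
          have hz' : ‖z‖ = r := by simpa using hz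
          rw [← hz']
          exact hb z (by rw [hz']; exact hrR))
      refine h.trans ?_
      rw [mul_div_assoc]
      gcongr
      rw [div_le_iff₀ (by positivity)]
      obtain ⟨j, rfl⟩ : ∃ j, n = K + 1 + j := ⟨n - (K + 1), by omega⟩
      have : 1 ≤ r ^ j := one_le_pow₀ hr1.le
      calc r ^ K = r ^ K * 1 := by ring
        _ ≤ r ^ K * r ^ j := by gcongr
        _ = r⁻¹ * r ^ (K + 1 + j) := by
          field_simp
          ring
    have hlim : Tendsto (fun r : ℝ => (n.factorial : ℝ) * r⁻¹) atTop (𝓝 0) := by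
      simpa using tendsto_inv_atTop_zero.const_mul (n.factorial : ℝ)
    have h0 : ‖iteratedDeriv n f 0‖ ≤ 0 := by
      refine ge_of_tendsto hlim ?_
      filter_upwards [eventually_gt_atTop (max R 1)] with r hr using hbound r hr
    exact norm_le_zero_iff.1 h0
  refine ⟨∑ n ∈ Finset.range (K + 1),
    monomial n ((n.factorial : ℂ)⁻¹ * iteratedDeriv n f 0), fun z => ?_⟩
  rw [← Complex.taylorSeries_eq_of_entire' 0 z hf, tsum_eq_sum (s := Finset.range (K + 1))]
  · rw [eval_finsetSum]
    simp
  · intro n hn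
    rw [hzero n (by simpa using hn)]
    simp

/-- Clearing poles on a compact set. -/
lemma clear_poles (g : ℂ → ℂ) (hg : ∀ z, MeromorphicAt g z) (s : Set ℂ) (hs : IsCompact s) :
    ∃ B : ℂ[X], B ≠ 0 ∧ ∀ z ∈ s, 0 ≤ meromorphicOrderAt (fun x => B.eval x * g x) z := by
  have hpol : ∀ (B : ℂ[X]) (z : ℂ), AnalyticAt ℂ (fun x => B.eval x) z :=
    fun B z => B.differentiable.analyticAt z
  have hmul : ∀ (A : ℂ[X]) (h : ℂ → ℂ) (z : ℂ), MeromorphicAt h z → 0 ≤ meromorphicOrderAt h z →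
      0 ≤ meromorphicOrderAt (fun x => A.eval x * h x) z := by
    intro A h z hh h0
    have := meromorphicOrderAt_mul (hpol A z).meromorphicAt hh
    refine le_trans ?_ this.ge
    exact add_nonneg (hpol A z).meromorphicOrderAt_nonneg h0
  refine hs.induction_on (p := fun s => ∃ B : ℂ[X], B ≠ 0 ∧
    ∀ z ∈ s, 0 ≤ meromorphicOrderAt (fun x => B.eval x * g x) z) ?_ ?_ ?_ ?_
  · exact ⟨1, one_ne_zero, by simp⟩
  · rintro s t hst ⟨B, hB, h⟩
    exact ⟨B, hB, fun z hz => h z (hst hz)⟩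
  · rintro s t ⟨B, hB, h⟩ ⟨B', hB', h'⟩
    refine ⟨B * B', mul_ne_zero hB hB', fun z hz => ?_⟩
    rcases hz with hz | hz
    · have := hmul B' _ z ((hpol B z).meromorphicAt.mul (hg z)) (h z hz)
      have e : (fun x => (B * B').eval x * g x) = fun x => B'.eval x * (B.eval x * g x) := by
        ext x
        rw [eval_mul]
        ring
      rw [e]
      exact this
    · have := hmul B _ z ((hpol B' z).meromorphicAt.mul (hg z)) (h' z hz)
      have e : (fun x => (B * B').eval x * g x) = fun x => B.eval x * (B'.eval x * g x) := by
        ext x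
        rw [eval_mul]
        ring
      rw [e]
      exact this
  · intro x hx
    obtain ⟨n, hn⟩ := hg x
    refine ⟨{z | 0 ≤ meromorphicOrderAt (fun y => ((X - C x) ^ n : ℂ[X]).eval y * g y) z},
      mem_nhdsWithin_of_mem_nhds ?_, (X - C x) ^ n, pow_ne_zero _ (X_sub_C_ne_zero x),
      fun z hz => hz⟩
    filter_upwards [hn.eventually_analyticAt] with z hz
    have := hz.meromorphicOrderAt_nonneg
    simpa [smul_eq_mul] using this

lemma rational_of_growth (g : ℂ → ℂ) (hg : ∀ z, MeromorphicAt g z) (K : ℕ) (R : ℝ) (hR : 2 ≤ R)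
    (hb : ∀ z : ℂ, R < ‖z‖ → ∀ᶠ x in 𝓝[≠] z, ‖g x‖ ≤ ‖x‖ ^ K) :
    ∃ A B : ℂ[X], B ≠ 0 ∧ ∀ z, ∀ᶠ x in 𝓝[≠] z, g x * B.eval x = A.eval x := by
  obtain ⟨B, hB, h⟩ := clear_poles g hg (Metric.closedBall 0 R) (isCompact_closedBall _ _)
  obtain ⟨b, hb'⟩ := poly_upper B
  set G : ℂ → ℂ := fun x => B.eval x * g x with hG
  have hGm : ∀ z, MeromorphicAt G z := fun z =>
    (B.differentiable.analyticAt z).meromorphicAt.mul (hg z)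
  have hGb : ∀ z : ℂ, R < ‖z‖ → ∀ᶠ x in 𝓝[≠] z, ‖G x‖ ≤ ‖x‖ ^ (b + K) := by
    intro z hz
    have h1 : ∀ᶠ x in 𝓝[≠] z, R < ‖x‖ :=
      (continuous_norm.continuousAt.eventually (lt_mem_nhds hz)).filter_mono nhdsWithin_le_nhds
    filter_upwards [hb z hz, h1] with x hx hx1
    rw [hG, norm_mul, pow_add]
    gcongr
    exact hb' x (by linarith)
  have hord : ∀ z, 0 ≤ meromorphicOrderAt G z := by
    intro z
    by_cases hz : ‖z‖ ≤ R
    · exact h z (by simpa using hz)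
    · by_contra hneg
      have ht := tendsto_cobounded_of_meromorphicOrderAt_neg (not_le.1 hneg)
      rw [← tendsto_norm_atTop_iff_cobounded] at ht
      have h1 := ht.eventually_gt_atTop ((‖z‖ + 1) ^ (b + K))
      have h2 : ∀ᶠ x in 𝓝[≠] z, ‖x‖ < ‖z‖ + 1 :=
        (continuous_norm.continuousAt.eventually
          (gt_mem_nhds (lt_add_one ‖z‖))).filter_mono nhdsWithin_le_nhds
      obtain ⟨x, hx1, hx2, hx3⟩ := (h1.and (h2.and (hGb z (not_le.1 hz)))).exists
      have : ‖x‖ ^ (b + K) ≤ (‖z‖ + 1) ^ (b + K) := by gcongr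
      linarith
  have hGon : MeromorphicOn G Set.univ := fun z _ => hGm z
  set f := toMeromorphicNFOn G Set.univ with hf
  have hfa : ∀ z, AnalyticAt ℂ f z := by
    intro z
    have hn : MeromorphicNFAt f z := (meromorphicNFOn_toMeromorphicNFOn G Set.univ) (Set.mem_univ z)
    rw [← hn.meromorphicOrderAt_nonneg_iff_analyticAt, hf,
      meromorphicOrderAt_toMeromorphicNFOn hGon (Set.mem_univ z)]
    exact hord z
  have hfG : ∀ z, G =ᶠ[𝓝[≠] z] f := fun z =>
    (hGon.toMeromorphicNFOn_eq_self_on_nhdsNE (Set.mem_univ z)).symm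
  obtain ⟨A, hA⟩ := entire_poly f (fun z => (hfa z).differentiableAt) (b + K) R (by
    intro z hz
    have h1 : Tendsto (fun x => ‖f x‖) (𝓝[≠] z) (𝓝 ‖f z‖) :=
      ((hfa z).continuousAt.norm).tendsto.mono_left nhdsWithin_le_nhds
    have h2 : Tendsto (fun x : ℂ => ‖x‖ ^ (b + K)) (𝓝[≠] z) (𝓝 (‖z‖ ^ (b + K))) :=
      ((continuous_norm.pow _).tendsto z).mono_left nhdsWithin_le_nhds
    refine le_of_tendsto_of_tendsto h1 h2 ?_
    filter_upwards [hGb z hz, hfG z] with x hx hx2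
    rwa [← hx2])
  refine ⟨A, B, hB, fun z => ?_⟩
  filter_upwards [hfG z] with x hx
  rw [← hA, ← hx, hG]
  ring

end MalmRat

section MalmMain

lemma deriv_est (P S T A B D : ℂ[X][X]) (R : ℂ[X]) (m : ℕ) (hm : 1 ≤ m)
    (hS : 1 ≤ S.natDegree) (hR : R ≠ 0)
    (hid : A * S + B * (derivative S * P * T) = C R) :
    ∃ (a b c : ℕ) (r : ℝ), 2 ≤ r ∧ ∀ z w d : ℂ, r ≤ ‖z‖ →
      (‖evZW S z w‖ ≤ 1 → ‖w‖ ≤ ‖z‖ ^ c) ∧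
      (d * (evZW S z w ^ m * evZW T z w) = evZW P z w →
      ‖z‖ ^ a * ‖evZW S z w‖ ≤ 1 →
      1 ≤ ‖z‖ ^ b * ‖((m + 1 : ℕ) : ℂ) * evZW S z w ^ m *
        (evZW D z w + evZW (derivative S) z w * d)‖) := by
  obtain ⟨r1, hr1, hroot⟩ := root_bound S hS
  obtain ⟨c, hc⟩ := hroot 0
  obtain ⟨r2, hr2, hlow⟩ := poly_lower R hR
  obtain ⟨α, hα⟩ := bi_upper A c
  obtain ⟨β, hβ⟩ := bi_upper B c
  obtain ⟨τ, hτ⟩ := bi_upper (T ^ 2) c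
  obtain ⟨σ, hσ⟩ := bi_upper (D * T ^ 2) c
  refine ⟨α + 2 + (β + 3 + σ), β + 3 + τ, c, max r1 r2, hr1.trans (le_max_left _ _), ?_⟩
  intro z w d hz
  have hz1 : r1 ≤ ‖z‖ := (le_max_left _ _).trans hz
  have hz2 : r2 ≤ ‖z‖ := (le_max_right _ _).trans hz
  have hx2 : 2 ≤ ‖z‖ := hr1.trans hz1
  have hwb : ‖evZW S z w‖ ≤ 1 → ‖w‖ ≤ ‖z‖ ^ c := fun h => hc z w hz1 (by simpa using h)
  refine ⟨hwb, fun hode hsmall => ?_⟩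
  have hpow1 : ∀ n : ℕ, 1 ≤ ‖z‖ ^ n := fun n => one_le_pow₀ (by linarith)
  have hs1 : ‖evZW S z w‖ ≤ 1 := by
    refine le_trans ?_ hsmall
    exact le_mul_of_one_le_left (norm_nonneg _) (hpow1 _)
  have hw := hwb hs1
  have hA := hα z w hx2 hw
  have hB := hβ z w hx2 hw
  have hT := hτ z w hx2 hw
  have hD := hσ z w hx2 hw
  have hR1 := hlow z hz2
  have hid' : R.eval z = evZW A z w * evZW S z w + evZW B z w *
      (evZW (derivative S) z w * evZW P z w * evZW T z w) := by
    rw [← evZW_C R z w, ← hid]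
    simp only [evZW_add, evZW_mul]
  rw [hid'] at hR1
  rw [evZW_mul, evZW_pow] at hD
  rw [evZW_pow] at hT
  generalize evZW S z w = s at *
  generalize evZW A z w = a at *
  generalize evZW B z w = b at *
  generalize evZW T z w = t at *
  generalize evZW P z w = p at *
  generalize evZW (derivative S) z w = q at *
  generalize evZW D z w = e at *
  set x := ‖z‖ with hx
  set N := q * p * t with hN
  have hx0 : 0 < x := by linarith
  -- s is small at various scales
  have hsA : x ^ (α + 2) * ‖s‖ ≤ 1 := by
    refine le_trans ?_ hsmall
    exact mul_le_mul_of_nonneg_right (pow_up hx2 (by omega)) (norm_nonneg _)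
  have hsB : x ^ (β + 3 + σ) * ‖s‖ ≤ 1 := by
    refine le_trans ?_ hsmall
    exact mul_le_mul_of_nonneg_right (pow_up hx2 (by omega)) (norm_nonneg _)
  have h1 : 1 ≤ x ^ (α + 1) * ‖s‖ + x ^ (β + 1) * ‖N‖ := by
    calc (1:ℝ) ≤ x * ‖a * s + b * N‖ := hR1
      _ ≤ x * (‖a‖ * ‖s‖ + ‖b‖ * ‖N‖) := by
        gcongr
        refine (norm_add_le _ _).trans ?_
        rw [norm_mul, norm_mul]
      _ ≤ x * (x ^ α * ‖s‖ + x ^ β * ‖N‖) := by gcongr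
      _ = _ := by ring
  have h2 : x ≤ 1 + x ^ (β + 2) * ‖N‖ := by
    calc x = x * 1 := by ring
      _ ≤ x * (x ^ (α + 1) * ‖s‖ + x ^ (β + 1) * ‖N‖) := by gcongr
      _ = x ^ (α + 2) * ‖s‖ + x ^ (β + 2) * ‖N‖ := by ring
      _ ≤ _ := by gcongr
  have h3 : 1 ≤ x ^ (β + 2) * ‖N‖ := by linarith
  have h4 : 2 ≤ x ^ (β + 3) * ‖N‖ := by
    calc (2:ℝ) ≤ x * 1 := by linarith
      _ ≤ x * (x ^ (β + 2) * ‖N‖) := by gcongr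
      _ = _ := by ring
  have hsm : ‖s ^ m‖ ≤ ‖s‖ := by
    rw [norm_pow]
    exact pow_le_of_le_one (norm_nonneg _) hs1 (by omega)
  have h5 : x ^ (β + 3) * ‖e * t ^ 2 * s ^ m‖ ≤ 1 := by
    refine le_trans ?_ hsB
    rw [norm_mul, pow_add x (β + 3) σ, mul_assoc]
    gcongr
  set U := ((m + 1 : ℕ) : ℂ) * s ^ m * (e + q * d) with hU
  have hUt : t ^ 2 * U = ((m + 1 : ℕ) : ℂ) * (e * t ^ 2 * s ^ m + N) := by
    rw [hU, hN, ← hode]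
    ring
  have h6 : ‖N‖ - ‖e * t ^ 2 * s ^ m‖ ≤ ‖t ^ 2 * U‖ := by
    rw [hUt, norm_mul ((m + 1 : ℕ) : ℂ), Complex.norm_natCast]
    have h7 : ‖N‖ - ‖e * t ^ 2 * s ^ m‖ ≤ ‖e * t ^ 2 * s ^ m + N‖ := by
      have := norm_sub_le_norm_add N (e * t ^ 2 * s ^ m)
      rwa [add_comm N] at this
    refine h7.trans (le_mul_of_one_le_left (norm_nonneg _) ?_)
    push_cast
    have : (0:ℝ) ≤ m := Nat.cast_nonneg m
    linarith
  calc (1:ℝ) ≤ x ^ (β + 3) * (‖N‖ - ‖e * t ^ 2 * s ^ m‖) := by rw [mul_sub]; linarith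
    _ ≤ x ^ (β + 3) * ‖t ^ 2 * U‖ := by gcongr
    _ = x ^ (β + 3) * (‖t ^ 2‖ * ‖U‖) := by rw [norm_mul]
    _ ≤ x ^ (β + 3) * (x ^ τ * ‖U‖) := by gcongr
    _ = _ := by rw [← mul_assoc, ← pow_add]

/-- Slope argument: a small function with large derivative on its sublevel set has a zero. -/
lemma slope_zero {u u' : ℂ → ℂ} {z0 : ℂ} {δ : ℝ} (hδ : 0 < δ) {K : Set ℂ} (hK : IsCompact K)
    (hz0 : z0 ∈ K) (hd : ∀ z ∈ K, HasDerivAt u (u' z) z) (hlow : ∀ z ∈ K, δ < ‖u' z‖)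
    (hnb : ∀ z ∈ K, dist z z0 < 1 → ∀ᶠ x in 𝓝 z, ‖u x‖ ≤ ‖u z‖ → x ∈ K)
    (hsmall : ‖u z0‖ < δ) : ∃ z ∈ K, u z = 0 := by
  have hcont : ContinuousOn (fun z => ‖u z‖ + δ * dist z z0) K := by
    intro z hz
    refine ContinuousAt.continuousWithinAt ?_
    have := (hd z hz).continuousAt
    fun_prop
  obtain ⟨z1, hz1, hmin⟩ := hK.exists_isMinOn ⟨z0, hz0⟩ hcont
  refine ⟨z1, hz1, ?_⟩
  by_contra hne
  have hm0 : ‖u z1‖ + δ * dist z1 z0 ≤ ‖u z0‖ := by simpa using hmin hz0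
  have hdist : dist z1 z0 < 1 := by
    have : δ * dist z1 z0 < δ * 1 := by
      have := norm_nonneg (u z1)
      linarith
    exact lt_of_mul_lt_mul_left this hδ.le
  set v := u' z1 with hv
  have hvl : δ < ‖v‖ := hlow z1 hz1
  have hv0 : v ≠ 0 := by
    rw [← norm_pos_iff]
    linarith
  have hupos : 0 < ‖u z1‖ := norm_pos_iff.2 hne
  set h0 : ℂ := - (u z1 / v) with hh0
  have hpath : HasDerivAt (fun t : ℝ => z1 + (t : ℂ) * h0) h0 0 := by
    have h := ((Complex.ofRealCLM.hasDerivAt (x := (0:ℝ))).mul_const h0).const_add z1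
    simpa using h
  have hF : HasDerivAt (fun t : ℝ => u (z1 + (t : ℂ) * h0)) (- u z1) 0 := by
    have hd1 : HasDerivAt u v (z1 + ((0:ℝ) : ℂ) * h0) := by simpa using hd z1 hz1
    have := hd1.comp (0:ℝ) hpath
    convert! this using 1
    rw [hh0]
    field_simp
  -- the gain
  have hgap : 0 < ‖u z1‖ * (1 - δ / ‖v‖) := by
    apply mul_pos hupos
    rw [sub_pos, div_lt_one (by linarith)]
    exact hvl
  have hlit := hF.isLittleO.def (half_pos hgap)
  have hcp : Tendsto (fun t : ℝ => z1 + (t : ℂ) * h0) (𝓝 0) (𝓝 z1) := by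
    simpa using hpath.continuousAt.tendsto
  have hnb' := hcp.eventually (hnb z1 hz1 hdist)
  have hall : ∀ᶠ t : ℝ in 𝓝[>] 0, t < 1 ∧ 0 < t ∧
      ‖u (z1 + (t : ℂ) * h0) - u (z1 + ((0:ℝ) : ℂ) * h0) - (t - 0) • (- u z1)‖ ≤
        ‖u z1‖ * (1 - δ / ‖v‖) / 2 * ‖t - 0‖ ∧
      (‖u (z1 + (t : ℂ) * h0)‖ ≤ ‖u z1‖ → z1 + (t : ℂ) * h0 ∈ K) := by
    filter_upwards [(gt_mem_nhds (zero_lt_one' ℝ)).filter_mono nhdsWithin_le_nhds,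
      self_mem_nhdsWithin, hlit.filter_mono nhdsWithin_le_nhds,
      hnb'.filter_mono nhdsWithin_le_nhds] with t h1 h2 h3 h4
    exact ⟨h1, h2, h3, h4⟩
  obtain ⟨t, ht1, ht0, hA, hB⟩ := hall.exists
  have hA' : ‖u (z1 + (t : ℂ) * h0) - ((1 - t : ℝ) : ℂ) * u z1‖ ≤
      ‖u z1‖ * (1 - δ / ‖v‖) / 2 * t := by
    have e : u (z1 + (t : ℂ) * h0) - u (z1 + ((0:ℝ) : ℂ) * h0) - (t - 0) • (- u z1) =
      u (z1 + (t : ℂ) * h0) - ((1 - t : ℝ) : ℂ) * u z1 := by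
      simp only [Complex.real_smul]
      push_cast
      simp
      ring
    rw [e] at hA
    simpa [abs_of_pos ht0] using hA
  have hnew : ‖u (z1 + (t : ℂ) * h0)‖ ≤ (1 - t) * ‖u z1‖ + ‖u z1‖ * (1 - δ / ‖v‖) / 2 * t := by
    have h1 := norm_le_norm_add_norm_sub' (u (z1 + (t : ℂ) * h0)) (((1 - t : ℝ) : ℂ) * u z1)
    have h2 : ‖((1 - t : ℝ) : ℂ) * u z1‖ = (1 - t) * ‖u z1‖ := by
      rw [norm_mul, Complex.norm_real, Real.norm_of_nonneg (by linarith)]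
    linarith
  have hdv : δ * (t * (‖u z1‖ / ‖v‖)) = t * (‖u z1‖ * (δ / ‖v‖)) := by ring
  have hdvnn : 0 ≤ δ / ‖v‖ := by positivity
  have hmem := hB (by nlinarith [mul_pos ht0 hgap, mul_nonneg ht0.le (mul_nonneg hupos.le hdvnn)])
  have hmin2 : ‖u z1‖ + δ * dist z1 z0 ≤
    ‖u (z1 + (t : ℂ) * h0)‖ + δ * dist (z1 + (t : ℂ) * h0) z0 := hmin hmem
  have hd2 : dist (z1 + (t : ℂ) * h0) z0 ≤ t * (‖u z1‖ / ‖v‖) + dist z1 z0 := by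
    refine (dist_triangle _ z1 _).trans ?_
    gcongr
    rw [dist_eq_norm, hh0]
    simp [abs_of_pos ht0]
  have hd3 := mul_le_mul_of_nonneg_left hd2 hδ.le
  nlinarith [mul_pos ht0 hgap]

end MalmMain

section MalmB

lemma lower_bound (P S T A B : ℂ[X][X]) (R : ℂ[X]) (m : ℕ) (hm : 1 ≤ m)
    (hS : 1 ≤ S.natDegree) (hR : R ≠ 0)
    (hid : A * S + B * (derivative S * P * T) = C R) (w : ℂ → ℂ)
    (hw : ∀ z, MeromorphicNFAt w z)
    (hode : ∀ z, AnalyticAt ℂ w z →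
      deriv w z * (evZW S z (w z) ^ m * evZW T z (w z)) = evZW P z (w z)) :
    ∃ (k : ℕ) (r : ℝ), 2 ≤ r ∧ ∀ z, r ≤ ‖z‖ → AnalyticAt ℂ w z →
      1 ≤ ‖z‖ ^ k * ‖evZW S z (w z)‖ := by
  obtain ⟨D, hD⟩ := ev_deriv S
  obtain ⟨a, b, c, r, hr, hest⟩ := deriv_est P S T A B D R m hm hS hR hid
  refine ⟨2 * a + (2 * b + 2), r + 1, by linarith, ?_⟩
  intro z0 hz0 hwz0
  by_contra hcon
  rw [not_le] at hcon
  set y : ℂ → ℂ := fun x => evZW S x (w x) with hy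
  set X0 := ‖z0‖ with hX0
  have hX2 : 2 ≤ X0 := by linarith
  have hX0p : 0 < X0 := by linarith
  have hcon' : X0 ^ (2 * a + (2 * b + 2)) * ‖y z0‖ < 1 := hcon
  have hpow1 : ∀ n : ℕ, 1 ≤ X0 ^ n := fun n => one_le_pow₀ (by linarith)
  have hya : X0 ^ (2 * a) * ‖y z0‖ ≤ 1 :=
    (mul_le_mul_of_nonneg_right (pow_up hX2 (by omega)) (norm_nonneg _)).trans hcon'.le
  have hyb : X0 ^ (2 * b + 2) * ‖y z0‖ < 1 :=
    (mul_le_mul_of_nonneg_right (pow_up hX2 (by omega)) (norm_nonneg _)).trans_lt hcon'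
  have hy1 : ‖y z0‖ ≤ 1 :=
    (le_mul_of_one_le_left (norm_nonneg _) (hpow1 _)).trans hya
  set K : Set ℂ := {z | z ∈ Metric.closedBall z0 1 ∧ AnalyticAt ℂ w z ∧ ‖y z‖ ≤ ‖y z0‖} with hK
  -- size comparison on the ball
  have hball : ∀ z ∈ Metric.closedBall z0 1, r ≤ ‖z‖ ∧ ‖z‖ ≤ X0 + 1 ∧ ‖z‖ ≤ X0 ^ 2 := by
    intro z hz
    rw [mem_closedBall_iff_norm] at hz
    have h1 : ‖z0‖ ≤ ‖z‖ + ‖z - z0‖ := by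
      have := norm_sub_le z (z - z0)
      simpa using this
    have h2 : ‖z‖ ≤ ‖z0‖ + ‖z - z0‖ := by
      have := norm_add_le z0 (z - z0)
      simpa using this
    refine ⟨by linarith, by linarith, ?_⟩
    nlinarith
  have hyd : ∀ z, AnalyticAt ℂ w z → HasDerivAt y
      (evZW D z (w z) + evZW (derivative S) z (w z) * deriv w z) z := fun z hz =>
    hD w z _ hz.differentiableAt.hasDerivAt
  have hKclosed : IsClosed K := by
    rw [isClosed_iff_frequently]
    intro z hz
    have hzb : z ∈ Metric.closedBall z0 1 := by
      have : IsClosed (Metric.closedBall z0 1) := Metric.isClosed_closedBall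
      exact isClosed_iff_frequently.1 this z (hz.mono fun x hx => hx.1)
    by_cases hza : AnalyticAt ℂ w z
    · refine ⟨hzb, hza, ?_⟩
      have hc : ContinuousAt (fun x => ‖y x‖) z := (hyd z hza).continuousAt.norm
      by_contra hlt
      have := hc.eventually (lt_mem_nhds (not_le.1 hlt))
      obtain ⟨x, hx1, hx2⟩ := (hz.and_eventually this).exists
      exact absurd hx1.2.2 (not_le.2 hx2)
    · exfalso
      have hord : meromorphicOrderAt w z < 0 := by
        by_contra hnn
        exact hza ((hw z).meromorphicOrderAt_nonneg_iff_analyticAt.1 (not_lt.1 hnn))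
      have ht := tendsto_cobounded_of_meromorphicOrderAt_neg hord
      rw [← tendsto_norm_atTop_iff_cobounded] at ht
      have h1 := ht.eventually_gt_atTop ((X0 + 1) ^ c)
      rw [eventually_nhdsWithin_iff] at h1
      obtain ⟨x, hx1, hx2⟩ := (hz.and_eventually h1).exists
      have hxz : x ≠ z := by
        rintro rfl
        exact hza hx1.2.1
      have h2 := hx2 hxz
      obtain ⟨hb1, hb2, -⟩ := hball x hx1.1
      have h3 := (hest x (w x) 0 hb1).1 (hx1.2.2.trans hy1)
      have h4 : ‖x‖ ^ c ≤ (X0 + 1) ^ c := by gcongr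
      linarith
  have hKc : IsCompact K := (isCompact_closedBall z0 1).of_isClosed_subset hKclosed fun z hz => hz.1
  have hz0K : z0 ∈ K := ⟨by simp, hwz0, le_rfl⟩
  set u' : ℂ → ℂ := fun z => ((m + 1 : ℕ) : ℂ) * y z ^ m *
    (evZW D z (w z) + evZW (derivative S) z (w z) * deriv w z) with hu'
  have hud : ∀ z ∈ K, HasDerivAt (fun x => y x ^ (m + 1)) (u' z) z := by
    intro z hz
    have := (hyd z hz.2.1).fun_pow (m + 1)
    simp only [Nat.add_sub_cancel] at this
    exact this
  have hlow1 : ∀ z ∈ K, 1 ≤ X0 ^ (2 * b) * ‖u' z‖ := by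
    intro z hz
    obtain ⟨hb1, hb2, hb3⟩ := hball z hz.1
    have hz2 := (hest z (w z) (deriv w z) hb1).2 (hode z hz.2.1) (by
      refine le_trans ?_ hya
      rw [pow_mul]
      have := hz.2.2
      gcongr)
    refine hz2.trans ?_
    rw [pow_mul]
    gcongr
  set δ := (X0 ^ (2 * b + 1))⁻¹ with hδ
  have hδ0 : 0 < δ := by positivity
  have hlow : ∀ z ∈ K, δ < ‖u' z‖ := by
    intro z hz
    have h1 := hlow1 z hz
    rw [hδ, inv_lt_iff_one_lt_mul₀ (by positivity)]
    have h2 : X0 ^ (2 * b + 1) * ‖u' z‖ = X0 * (X0 ^ (2 * b) * ‖u' z‖) := by ring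
    nlinarith
  obtain ⟨z1, hz1, hzero⟩ := slope_zero (u := fun x => y x ^ (m + 1)) (u' := u') hδ0 hKc hz0K hud
    hlow (by
      intro z hz hd
      have h1 : ∀ᶠ x in 𝓝 z, dist x z0 < 1 :=
        (continuous_id.dist continuous_const).continuousAt.eventually (gt_mem_nhds hd)
      filter_upwards [h1, hz.2.1.eventually_analyticAt] with x hx1 hx2 hx3
      refine ⟨Metric.mem_closedBall.2 hx1.le, hx2, ?_⟩
      simp only [norm_pow] at hx3
      exact (le_of_pow_le_pow_left₀ (Nat.succ_ne_zero m) (norm_nonneg _) hx3).trans hz.2.2) (by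
      have h1 : ‖y z0 ^ (m + 1)‖ ≤ ‖y z0‖ := by
        rw [norm_pow]
        exact pow_le_of_le_one (norm_nonneg _) hy1 (Nat.succ_ne_zero m)
      refine h1.trans_lt ?_
      rw [hδ, ← one_div, lt_div_iff₀ (by positivity), mul_comm]
      exact (mul_le_mul_of_nonneg_right (pow_up hX2 (by omega)) (norm_nonneg _)).trans_lt hyb)
  have hy0 : y z1 = 0 := by simpa using hzero
  have h1 := hlow1 z1 hz1
  have h2 : u' z1 = 0 := by
    simp only [hu']
    rw [hy0, zero_pow (by omega)]
    ring
  rw [h2] at h1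
  norm_num at h1

lemma main_lemma (P S T A B : ℂ[X][X]) (R : ℂ[X]) (m : ℕ) (hm : 1 ≤ m)
    (hS : 1 ≤ S.natDegree) (hR : R ≠ 0)
    (hid : A * S + B * (derivative S * P * T) = C R) (w0 : ℂ → ℂ)
    (hw0 : MeromorphicOn w0 Set.univ)
    (hode0 : ∀ z, ∀ᶠ x in 𝓝[≠] z,
      deriv w0 x * (evZW S x (w0 x) ^ m * evZW T x (w0 x)) = evZW P x (w0 x)) :
    ∃ A B : ℂ[X], B ≠ 0 ∧ ∀ z, ∀ᶠ x in 𝓝[≠] z, w0 x * B.eval x = A.eval x := by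
  set w := toMeromorphicNFOn w0 Set.univ with hwdef
  have hw : ∀ z, MeromorphicNFAt w z := fun z =>
    (meromorphicNFOn_toMeromorphicNFOn w0 Set.univ) (Set.mem_univ z)
  have hww : ∀ z, w0 =ᶠ[𝓝[≠] z] w := fun z =>
    (hw0.toMeromorphicNFOn_eq_self_on_nhdsNE (Set.mem_univ z)).symm
  have hww' : ∀ z, ∀ᶠ x in 𝓝[≠] z, w0 =ᶠ[𝓝 x] w := by
    intro z
    have h := hww z
    rw [EventuallyEq, eventually_nhdsWithin_iff, ← eventually_eventually_nhds] at h
    rw [eventually_nhdsWithin_iff]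
    filter_upwards [h] with x hx hxz
    filter_upwards [hx, isOpen_compl_singleton.mem_nhds hxz] with t ht1 ht2 using ht1 ht2
  have hode : ∀ z, AnalyticAt ℂ w z →
      deriv w z * (evZW S z (w z) ^ m * evZW T z (w z)) = evZW P z (w z) := by
    intro z hz
    have hc : ContinuousAt (fun z => deriv w z * (evZW S z (w z) ^ m * evZW T z (w z))) z :=
      (hz.deriv.mul (((ev_analytic S w z hz).pow m).mul (ev_analytic T w z hz))).continuousAt
    have hc2 : ContinuousAt (fun z => evZW P z (w z)) z := (ev_analytic P w z hz).continuousAt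
    refine tendsto_nhds_unique_of_eventuallyEq (hc.tendsto.mono_left nhdsWithin_le_nhds)
      (hc2.tendsto.mono_left nhdsWithin_le_nhds) (l := 𝓝[≠] z) ?_
    filter_upwards [hode0 z, hww' z] with x hx1 hx2
    rw [← hx2.deriv_eq, ← hx2.self_of_nhds]
    exact hx1
  obtain ⟨k, r, hr, hlow⟩ := lower_bound P S T A B R m hm hS hR hid w hw hode
  have hwm : ∀ z, MeromorphicAt w z := fun z => (hw z).meromorphicAt
  have han : ∀ z, ∀ᶠ x in 𝓝[≠] z, AnalyticAt ℂ w x := fun z => (hwm z).eventually_analyticAt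
  have hfar : ∀ (ρ : ℝ) (z : ℂ), ρ < ‖z‖ → ∀ᶠ x in 𝓝[≠] z, ρ < ‖x‖ := fun ρ z hz =>
    (continuous_norm.continuousAt.eventually (lt_mem_nhds hz)).filter_mono nhdsWithin_le_nhds
  -- the reciprocal of `S(z,w)` is rational
  obtain ⟨A1, B1, hB1, h1⟩ := rational_of_growth (fun x => (evZW S x (w x))⁻¹)
    (fun z => (ev_mero S w z (hwm z)).inv) k r hr (by
      intro z hz
      filter_upwards [han z, hfar r z hz] with x hx1 hx2
      have h := hlow x hx2.le hx1
      have hpos : 0 < ‖evZW S x (w x)‖ := by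
        by_contra hn
        have : ‖evZW S x (w x)‖ = 0 := le_antisymm (not_lt.1 hn) (norm_nonneg _)
        rw [this] at h
        norm_num at h
      rw [norm_inv, inv_le_iff_one_le_mul₀ hpos]
      exact h)
  obtain ⟨e, he⟩ := poly_upper B1
  obtain ⟨r1, hr1, hroot⟩ := root_bound S hS
  obtain ⟨r3, hr3, hB1low⟩ := poly_lower B1 hB1
  -- `A1` is nonzero
  have hA1 : A1 ≠ 0 := by
    rintro rfl
    set ρ := max r r3 with hρ
    have hz : ρ < ‖((ρ + 1 : ℝ) : ℂ)‖ := by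
      rw [Complex.norm_real]
      exact (lt_add_one ρ).trans_le (le_abs_self _)
    obtain ⟨x, hx1, hx2, hx3⟩ := ((h1 _).and ((han _).and (hfar ρ _ hz))).exists
    have ha := hlow x ((le_max_left _ _).trans hx3.le) hx2
    have hb := hB1low x ((le_max_right _ _).trans hx3.le)
    simp only [eval_zero, mul_eq_zero, inv_eq_zero] at hx1
    rcases hx1 with h | h
    · rw [h] at ha
      norm_num at ha
    · rw [h] at hb
      norm_num at hb
  obtain ⟨r2, hr2, hA1low⟩ := poly_lower A1 hA1
  obtain ⟨k2, hk2⟩ := hroot (e + 1)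
  obtain ⟨A2, B2, hB2, h2⟩ := rational_of_growth w hwm k2 (max r (max r1 r2))
    (hr.trans (le_max_left _ _)) (by
      intro z hz
      filter_upwards [han z, hfar _ z hz, h1 z] with x hx1 hx2 hx3
      have hxr : r ≤ ‖x‖ := (le_max_left _ _).trans hx2.le
      have hxr1 : r1 ≤ ‖x‖ := ((le_max_left _ _).trans (le_max_right _ _)).trans hx2.le
      have hxr2 : r2 ≤ ‖x‖ := ((le_max_right _ _).trans (le_max_right _ _)).trans hx2.le
      apply hk2 x (w x) hxr1
      have hS0 : evZW S x (w x) ≠ 0 := by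
        intro h0
        have := hlow x hxr hx1
        rw [h0] at this
        norm_num at this
      have hBA : B1.eval x = A1.eval x * evZW S x (w x) := by
        rw [← hx3]
        field_simp
      have hBx := he x (hr.trans hxr)
      rw [hBA, norm_mul] at hBx
      have hAx := hA1low x hxr2
      calc ‖evZW S x (w x)‖ = 1 * ‖evZW S x (w x)‖ := by ring
        _ ≤ (‖x‖ * ‖A1.eval x‖) * ‖evZW S x (w x)‖ := by gcongr
        _ = ‖x‖ * (‖A1.eval x‖ * ‖evZW S x (w x)‖) := by ring
        _ ≤ ‖x‖ * ‖x‖ ^ e := by gcongr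
        _ = _ := by ring)
  refine ⟨A2, B2, hB2, fun z => ?_⟩
  filter_upwards [h2 z, hww z] with x hx1 hx2
  rw [hx2, hx1]

end MalmB
section MalmC

lemma exists_factor (Q : ℂ[X][X]) (hQ : Q ≠ 0) :
    1 ≤ Q.natDegree → ∃ S : ℂ[X][X], Prime S ∧ S ∣ Q ∧ 1 ≤ S.natDegree := by
  induction Q using UniqueFactorizationMonoid.induction_on_prime with
  | h₁ => exact absurd rfl hQ
  | h₂ x hx =>
    intro h
    have := natDegree_eq_zero_of_isUnit hx
    omega
  | h₃ a p ha hp ih =>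
    intro h
    rw [natDegree_mul hp.ne_zero ha] at h
    by_cases hd : 1 ≤ p.natDegree
    · exact ⟨p, hp, dvd_mul_right _ _, hd⟩
    · obtain ⟨S, h1, h2, h3⟩ := ih ha (by omega)
      exact ⟨S, h1, h2.mul_left p, h3⟩

lemma bezout (S N : ℂ[X][X]) (hS : Prime S) (hd : 1 ≤ S.natDegree) (hN : ¬ S ∣ N) :
    ∃ (A B : ℂ[X][X]) (R : ℂ[X]), R ≠ 0 ∧ A * S + B * N = C R := by
  have hprim : S.IsPrimitive := hS.irreducible.isPrimitive (by omega)
  have hirr : Irreducible (S.map (algebraMap ℂ[X] (RatFunc ℂ))) :=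
    (hprim.irreducible_iff_irreducible_map_fraction_map (K := RatFunc ℂ)).1 hS.irreducible
  have hnd : ¬ S.map (algebraMap ℂ[X] (RatFunc ℂ)) ∣ N.map (algebraMap ℂ[X] (RatFunc ℂ)) := by
    intro h
    exact hN (hprim.dvd_of_fraction_map_dvd_fraction_map h)
  have hc := (hirr.coprime_iff_not_dvd).2 hnd
  obtain ⟨a, b, hab⟩ := hc
  obtain ⟨r, hr, hr2⟩ := IsLocalization.integerNormalization_spec (nonZeroDivisors ℂ[X]) a
  obtain ⟨s, hs, hs2⟩ := IsLocalization.integerNormalization_spec (nonZeroDivisors ℂ[X]) b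
  generalize IsLocalization.integerNormalization (nonZeroDivisors ℂ[X]) a = A at hr2
  generalize IsLocalization.integerNormalization (nonZeroDivisors ℂ[X]) b = B at hs2
  rw [← IsScalarTower.algebraMap_smul (RatFunc ℂ), smul_eq_C_mul] at hr2 hs2
  refine ⟨C s * A, C r * B, r * s,
    mul_ne_zero (nonZeroDivisors.ne_zero hr) (nonZeroDivisors.ne_zero hs), ?_⟩
  apply Polynomial.map_injective _ (IsFractionRing.injective ℂ[X] (RatFunc ℂ))
  simp only [Polynomial.map_add, Polynomial.map_mul, map_C, hr2, hs2, C_mul, RingHom.map_mul]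
  linear_combination (C (algebraMap ℂ[X] (RatFunc ℂ) r) * C (algebraMap ℂ[X] (RatFunc ℂ) s)) * hab

lemma poly_ne (B : ℂ[X]) (hB : B ≠ 0) (z : ℂ) : ∀ᶠ x in 𝓝[≠] z, B.eval x ≠ 0 := by
  have hf : ({x | IsRoot B x} \ {z}).Finite := (finite_setOf_isRoot hB).subset Set.diff_subset
  have hn := hf.isClosed.isOpen_compl.mem_nhds (x := z) (by simp)
  rw [eventually_nhdsWithin_iff]
  filter_upwards [hn] with x hx hxz h0
  exact hx ⟨h0, hxz⟩

lemma case_pos (P Q : ℂ[X][X]) (hQ : Q ≠ 0)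
    (hcop : IsCoprime (P.map (algebraMap (Polynomial ℂ) (RatFunc ℂ)))
                      (Q.map (algebraMap (Polynomial ℂ) (RatFunc ℂ))))
    (hd : 1 ≤ Q.natDegree)
    (w : ℂ → ℂ) (hw : MeromorphicOn w Set.univ)
    (hode : ∀ z, ∀ᶠ x in 𝓝[≠] z, deriv w x * evZW Q x (w x) = evZW P x (w x)) :
    ∃ A B : ℂ[X], B ≠ 0 ∧ ∀ z, ∀ᶠ x in 𝓝[≠] z, w x * B.eval x = A.eval x := by
  obtain ⟨S, hSp, hSQ, hSd⟩ := exists_factor Q hQ hd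
  obtain ⟨T, hT, hTd⟩ :=
    (FiniteMultiplicity.of_not_isUnit hSp.not_isUnit hQ).exists_eq_pow_mul_and_not_dvd
  have hm : 1 ≤ multiplicity S Q := by
    by_contra h
    have h0 : multiplicity S Q = 0 := by omega
    rw [h0, pow_zero, one_mul] at hT
    exact hTd (hT ▸ hSQ)
  generalize multiplicity S Q = m at *
  have h1 : ¬ S ∣ derivative S := by
    intro h
    have hne : derivative S ≠ 0 := by
      intro h0
      have := derivative_eq_zero.1 h0
      omega
    have h2 := natDegree_le_of_dvd h hne
    have h3 := natDegree_derivative_lt (p := S) (by omega)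
    omega
  have h2 : ¬ S ∣ P := by
    intro h
    have hu := hcop.isUnit_of_dvd' (Polynomial.map_dvd _ h) (Polynomial.map_dvd _ hSQ)
    have := natDegree_eq_zero_of_isUnit hu
    rw [natDegree_map_eq_of_injective (IsFractionRing.injective ℂ[X] (RatFunc ℂ))] at this
    omega
  have h3 : ¬ S ∣ derivative S * P * T := by
    intro h
    rcases hSp.dvd_or_dvd h with h | h
    · rcases hSp.dvd_or_dvd h with h | h
      · exact h1 h
      · exact h2 h
    · exact hTd h
  obtain ⟨A, B, R, hR, hid⟩ := bezout S _ hSp hSd h3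
  refine main_lemma P S T A B R m hm hSd hR hid w hw fun z => ?_
  filter_upwards [hode z] with x hx
  rw [← hx, hT, evZW_mul, evZW_pow]

lemma ev_reverse (P : ℂ[X][X]) (z w : ℂ) (hw : w ≠ 0) :
    evZW P.reverse z w⁻¹ * w ^ P.natDegree = evZW P z w := by
  letI := invertibleOfNonzero hw
  have := eval₂_reverse_mul_pow (evalRingHom z) w P
  simp only [evZW, eval_map]
  rwa [invOf_eq_inv] at this

lemma case_zero (P : ℂ[X][X]) (b : ℂ[X]) (hb : b ≠ 0) (hd : 3 ≤ P.natDegree)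
    (w : ℂ → ℂ) (hw : MeromorphicOn w Set.univ)
    (hode : ∀ z, ∀ᶠ x in 𝓝[≠] z, deriv w x * b.eval x = evZW P x (w x)) :
    ∃ A B : ℂ[X], B ≠ 0 ∧ ∀ z, ∀ᶠ x in 𝓝[≠] z, w x * B.eval x = A.eval x := by
  by_cases htop : ∀ z, meromorphicOrderAt w z = ⊤
  · refine ⟨0, 1, one_ne_zero, fun z => ?_⟩
    filter_upwards [meromorphicOrderAt_eq_top_iff.1 (htop z)] with x hx
    simp [hx]
  push Not at htop
  obtain ⟨z0, hz0⟩ := htop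
  have hnt : ∀ z, ∀ᶠ x in 𝓝[≠] z, w x ≠ 0 := by
    intro z
    rw [← meromorphicOrderAt_ne_top_iff_eventually_ne_zero (hw z (Set.mem_univ z))]
    exact hw.meromorphicOrderAt_ne_top_of_isPreconnected isPreconnected_univ
      (Set.mem_univ z0) (Set.mem_univ z) hz0
  have hP0 : P ≠ 0 := by
    rintro rfl
    simp at hd
  obtain ⟨A1, B1, hB1, h1⟩ := main_lemma (-P.reverse) X (C b) (C b * P.reverse.divX) 1
    (-(b * P.leadingCoeff)) (P.natDegree - 2) (by omega) (by simp)
    (neg_ne_zero.2 (mul_ne_zero hb (leadingCoeff_ne_zero.2 hP0))) (by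
      have h := divX_mul_X_add P.reverse
      rw [coeff_zero_reverse] at h
      rw [derivative_X, C_neg, C_mul]
      linear_combination (C b) * h) w⁻¹ (fun z hz => (hw z hz).inv) (by
      intro z
      filter_upwards [hode z, hnt z, (hw z (Set.mem_univ z)).eventually_analyticAt]
        with x hx1 hx2 hx3
      have hdv : deriv w⁻¹ x = -deriv w x / w x ^ 2 :=
        (hx3.differentiableAt.hasDerivAt.inv hx2).deriv
      obtain ⟨k, hk⟩ := Nat.exists_eq_add_of_le' (show 2 ≤ P.natDegree by omega)
      have hr := ev_reverse P x (w x) hx2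
      rw [hdv, evZW_X, evZW_C, evZW_neg, Pi.inv_apply]
      rw [hk] at hr ⊢
      rw [← hx1] at hr
      rw [Nat.add_sub_cancel]
      generalize evZW P.reverse x (w x)⁻¹ = e at hr ⊢
      have hi : w x * (w x)⁻¹ = 1 := mul_inv_cancel₀ hx2
      have hi2 : (w x) ^ (k + 2) * ((w x)⁻¹) ^ (k + 2) = 1 := by rw [← mul_pow, hi, one_pow]
      calc -deriv w x / w x ^ 2 * ((w x)⁻¹ ^ k * eval x b)
          = -((deriv w x * eval x b) * (w x)⁻¹ ^ (k + 2)) := by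
            rw [div_eq_mul_inv, ← inv_pow]
            ring
        _ = -(e * (w x ^ (k + 2) * (w x)⁻¹ ^ (k + 2))) := by rw [← hr]; ring
        _ = -e := by rw [hi2, mul_one])
  have hA1 : A1 ≠ 0 := by
    rintro rfl
    obtain ⟨x, hx1, hx2, hx3⟩ := ((h1 0).and ((hnt 0).and (poly_ne B1 hB1 0))).exists
    simp [hx2, hx3] at hx1
  refine ⟨B1, A1, hA1, fun z => ?_⟩
  filter_upwards [h1 z, hnt z] with x hx1 hx2
  rw [← hx1, Pi.inv_apply]
  field_simp

end MalmC

theorem malmquist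
    (P Q : Polynomial (Polynomial ℂ)) (hQ : Q ≠ 0)
    (hcop : IsCoprime (P.map (algebraMap (Polynomial ℂ) (RatFunc ℂ)))
                      (Q.map (algebraMap (Polynomial ℂ) (RatFunc ℂ))))
    (hnotRiccati : ¬ (Q.natDegree = 0 ∧ P.natDegree ≤ 2))
    (w : ℂ → ℂ) (hw : MeromorphicOn w Set.univ)
    (hode : ∀ z : ℂ, AnalyticAt ℂ w z →
      deriv w z * evZW Q z (w z) = evZW P z (w z)) :
    ∃ A B : Polynomial ℂ, B ≠ 0 ∧
      ∀ z : ℂ, AnalyticAt ℂ w z → w z * B.eval z = A.eval z := by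
  have hode' : ∀ z, ∀ᶠ x in 𝓝[≠] z, deriv w x * evZW Q x (w x) = evZW P x (w x) := by
    intro z
    filter_upwards [(hw z (Set.mem_univ z)).eventually_analyticAt] with x hx using hode x hx
  have key : ∃ A B : ℂ[X], B ≠ 0 ∧ ∀ z, ∀ᶠ x in 𝓝[≠] z, w x * B.eval x = A.eval x := by
    by_cases hd : 1 ≤ Q.natDegree
    · exact case_pos P Q hQ hcop hd w hw hode'
    · have hd0 : Q.natDegree = 0 := by omega
      obtain ⟨b, rfl⟩ := natDegree_eq_zero.1 hd0
      refine case_zero P b (fun h => hQ (by rw [h, C_0])) ?_ w hw ?_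
      · by_contra h
        exact hnotRiccati ⟨hd0, by omega⟩
      · intro z
        filter_upwards [hode' z] with x hx
        rwa [evZW_C] at hx
  obtain ⟨A, B, hB, h⟩ := key
  refine ⟨A, B, hB, fun z hz => ?_⟩
  have hc : ContinuousAt (fun x => w x * B.eval x) z := hz.continuousAt.mul B.continuousAt
  exact tendsto_nhds_unique_of_eventuallyEq (hc.tendsto.mono_left nhdsWithin_le_nhds)
    (A.continuousAt.tendsto.mono_left nhdsWithin_le_nhds) (l := 𝓝[≠] z) (h z)
end
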